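/- arXiv:1111.4500 — 3 statements merged into one kernel-verified Lean document; each statement's English description precedes it below -/
import Mathlib

section
/- Generator ε-machines are unique: if M_1 = (𝒮_1, 𝒳, {T_1^(x)}) and M_2 = (𝒮_2, 𝒳, {T_2^(x)}) are generator ε-machines with stationary distributions π_1 and π_2 such that ‖π_1 T_1^(w)‖₁ = ‖π_2 T_2^(w)‖₁ for every word w ∈ 𝒳* (i.e., they generate the same process), then M_1 and M_2 are isomorphic: there is a bijection f : 𝒮_1 → 𝒮_2 with (T_1^(x))_{ij} = (T_2^(x))_{f(i) f(j)} for all states i, j and symbols x ∈ 𝒳. -/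
open MeasureTheory Filter Topology
open scoped Classical

namespace EM

variable {X : Type*} [Fintype X] [MeasurableSpace X] [MeasurableSingletonClass X]

/-- The left shift on bi-infinite sequences. -/
def shift (ω : ℤ → X) : ℤ → X := fun n => ω (n + 1)

/-- ℙ(w): probability of the cylinder set of the word `w` at position 0. -/
noncomputable def wordProb (μ : Measure (ℤ → X)) (w : List X) : ℝ :=
  (μ {ω | ∀ k : Fin w.length, ω ((k : ℕ) : ℤ) = w.get k}).toReal

/-- Stationarity: invariance of the measure under the shift. -/
def Stationary (μ : Measure (ℤ → X)) : Prop := Measure.map shift μ = μ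

/-- Ergodicity: every shift-invariant measurable event is trivial. -/
def Ergodic' (μ : Measure (ℤ → X)) : Prop :=
  ∀ A : Set (ℤ → X), MeasurableSet A → shift ⁻¹' A = A → μ A = 0 ∨ μ A = 1

/-- Projection of a bi-infinite sequence to its past:  (pastMap ω) n = x_{-(n+1)}. -/
def pastMap (ω : ℤ → X) : ℕ → X := fun n => ω (-((n : ℤ) + 1))

/-- ℙ⁻ : the marginal of ℙ on past sequences. -/
noncomputable def pastMeasure (μ : Measure (ℤ → X)) : Measure (ℕ → X) :=
  Measure.map pastMap μ

/-- x⃖^t = x_{-t} … x_{-1}, the last `t` symbols of the past `p`, as a word. -/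
def pastWord (p : ℕ → X) (t : ℕ) : List X := (List.range t).reverse.map p

/-- A past is nontrivial if all of its finite suffixes have positive probability. -/
def Nontrivial' (μ : Measure (ℤ → X)) (p : ℕ → X) : Prop :=
  ∀ t : ℕ, 0 < wordProb μ (pastWord p t)

/-- ℙ(w | v) = ℙ(vw)/ℙ(v): conditional probability that `w` follows `v`. -/
noncomputable def condProb (μ : Measure (ℤ → X)) (w v : List X) : ℝ :=
  wordProb μ (v ++ w) / wordProb μ v

/-- A past is `w`-regular if it is nontrivial and lim_{t→∞} ℙ(w|x⃖^t) exists. -/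
def WRegular (μ : Measure (ℤ → X)) (p : ℕ → X) (w : List X) : Prop :=
  Nontrivial' μ p ∧ ∃ L : ℝ, Tendsto (fun t => condProb μ w (pastWord p t)) atTop (𝓝 L)

/-- A past is regular if it is nontrivial and `w`-regular for every nonempty word `w`. -/
def Regular (μ : Measure (ℤ → X)) (p : ℕ → X) : Prop :=
  Nontrivial' μ p ∧ ∀ w : List X, w ≠ [] →
    ∃ L : ℝ, Tendsto (fun t => condProb μ w (pastWord p t)) atTop (𝓝 L)

/-- 𝐏(w|x⃖) = lim_{t→∞} ℙ(w|x⃖^t)  (meaningful for regular pasts). -/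
noncomputable def predProb (μ : Measure (ℤ → X)) (p : ℕ → X) (w : List X) : ℝ :=
  limUnder atTop (fun t => condProb μ w (pastWord p t))

/-- The past x⃖x obtained by appending the symbol `x` to the past x⃖. -/
def extendPast (p : ℕ → X) (x : X) : ℕ → X
  | 0 => x
  | n + 1 => p n

/-- The past obtained by appending a word symbol by symbol. -/
def extendWord (p : ℕ → X) : List X → (ℕ → X)
  | [] => p
  | x :: u => extendWord (extendPast p x) u

/-- The predictive equivalence class of the (regular) past `p`. -/
def classOf (μ : Measure (ℤ → X)) (p : ℕ → X) : Set (ℕ → X) :=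
  {q | Regular μ q ∧ ∀ w : List X, w ≠ [] → predProb μ q w = predProb μ p w}

section HMM

variable {S : Type*} [Fintype S] [DecidableEq S]

/-- T^(w) = T^(w₀) ⋯ T^(w_{l-1}). -/
def wordMatrix (T : X → Matrix S S ℝ) (w : List X) : Matrix S S ℝ :=
  (w.map T).prod

/-- 𝐏_{σ_i}(w) = ‖e_i T^(w)‖₁, the probability of emitting `w` from state `i`. -/
noncomputable def stateWordProb (T : X → Matrix S S ℝ) (i : S) (w : List X) : ℝ :=
  ∑ j, wordMatrix T w i j

/-- All transition matrices have nonnegative entries. -/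
def HMMNonneg (T : X → Matrix S S ℝ) : Prop := ∀ x i j, 0 ≤ T x i j

/-- The overall transition matrix T = Σ_x T^(x) is row-stochastic. -/
def HMMStochastic (T : X → Matrix S S ℝ) : Prop := ∀ i, ∑ x : X, ∑ j, T x i j = 1

/-- The overall state-to-state transition matrix T = Σ_x T^(x). -/
noncomputable def totalT (T : X → Matrix S S ℝ) : Matrix S S ℝ := ∑ x : X, T x

/-- Irreducibility: the directed graph with an edge i → j whenever T_{ij} > 0 is
strongly connected. -/
def Irreducible' (T : X → Matrix S S ℝ) : Prop :=
  ∀ i j : S, ∃ n : ℕ, 0 < n ∧ 0 < (totalT T ^ n) i j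

/-- Unifilarity: from each state, each symbol leads to at most one state. -/
def Unifilar (T : X → Matrix S S ℝ) : Prop :=
  ∀ (x : X) (i j k : S), 0 < T x i j → 0 < T x i k → j = k

/-- Probabilistically distinct states. -/
def ProbDistinct (T : X → Matrix S S ℝ) : Prop :=
  ∀ i j : S, i ≠ j → ∃ w : List X, w ≠ [] ∧ stateWordProb T i w ≠ stateWordProb T j w

/-- π is a stationary distribution for the HMM: π ≥ 0, Σπ = 1, π = πT. -/
def IsStationaryDist (T : X → Matrix S S ℝ) (π : S → ℝ) : Prop :=
  (∀ i, 0 ≤ π i) ∧ (∑ i, π i = 1) ∧ (∀ j, ∑ i, π i * totalT T i j = π j)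

/-- A generator ε-machine: a valid, irreducible, unifilar HMM with
probabilistically distinct states. -/
def IsGenEM (T : X → Matrix S S ℝ) : Prop :=
  HMMNonneg T ∧ HMMStochastic T ∧ Irreducible' T ∧ Unifilar T ∧ ProbDistinct T

/-- The set of regular pasts whose predictions agree with state `i` of the HMM `T`. -/
def stateClass (μ : Measure (ℤ → X)) (T : X → Matrix S S ℝ) (i : S) : Set (ℕ → X) :=
  {q | Regular μ q ∧ ∀ w : List X, w ≠ [] → predProb μ q w = stateWordProb T i w}

end HMM

/-- The symbol-labeled transition matrices of the history ε-machine, given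
representatives `p i` of the positive-probability predictive equivalence classes:
T^(x)_{ij} = 𝐏(x|E_i) if 𝐏(x|E_i) > 0 and δ_h(E_i,x) = E_j, and 0 otherwise. -/
noncomputable def histT (μ : Measure (ℤ → X)) {N : ℕ} (p : Fin N → (ℕ → X)) (x : X) :
    Matrix (Fin N) (Fin N) ℝ := fun i j =>
  if 0 < predProb μ (p i) [x] ∧ classOf μ (extendPast (p i) x) = classOf μ (p j)
  then predProb μ (p i) [x] else 0

/-- ℙ is finitely characterized, with the pasts `p i` representing the finitely many
positive-probability predictive equivalence classes E_i = classOf μ (p i). -/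
def FinitelyCharacterized (μ : Measure (ℤ → X)) {N : ℕ} (p : Fin N → (ℕ → X)) : Prop :=
  (∀ i, Regular μ (p i)) ∧
  (∀ i j : Fin N, i ≠ j → classOf μ (p i) ≠ classOf μ (p j)) ∧
  (∀ i, 0 < pastMeasure μ (classOf μ (p i))) ∧
  (∑ i, pastMeasure μ (classOf μ (p i)) = 1)

end EM

namespace EM

lemma exists_pos_of_sum_pos {ι : Type*} [Fintype ι] {f : ι → ℝ} (h : 0 < ∑ i, f i) :
    ∃ i, 0 < f i := by
  by_contra! hc
  exact absurd h (not_lt.2 (Finset.sum_nonpos fun i _ => hc i))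

lemma Unifilar.eq_zero_of_ne {X S : Type*} {T : X → Matrix S S ℝ} (hU : Unifilar T) (hT : HMMNonneg T)
    {x : X} {i j k : S} (hj : 0 < T x i j) (hk : k ≠ j) : T x i k = 0 := by
  by_contra h
  exact hk (hU x i k j (lt_of_le_of_ne (hT x i k) (Ne.symm h)) hj)

section SingleMachine

variable {X S : Type*} [Fintype S]

/-- The probability of emitting the symbol `x` from the state `i`. -/
noncomputable def emissionProb (T : X → Matrix S S ℝ) (i : S) (x : X) : ℝ := ∑ j, T x i j

lemma emissionProb_nonneg {T : X → Matrix S S ℝ} (hT : HMMNonneg T) (i : S) (x : X) :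
    0 ≤ emissionProb T i x := Finset.sum_nonneg fun j _ => hT x i j

lemma emissionProb_eq {T : X → Matrix S S ℝ} (hU : Unifilar T) (hT : HMMNonneg T)
    {x : X} {i j : S} (hj : 0 < T x i j) : emissionProb T i x = T x i j :=
  Finset.sum_eq_single_of_mem j (Finset.mem_univ j) fun _ _ hk => hU.eq_zero_of_ne hT hj hk

lemma exists_pos_of_emissionProb_pos {T : X → Matrix S S ℝ} {x : X} {i : S}
    (h : 0 < emissionProb T i x) : ∃ j, 0 < T x i j :=
  exists_pos_of_sum_pos h

lemma emissionProb_eq_zero_iff {T : X → Matrix S S ℝ} (hT : HMMNonneg T) {x : X} {i : S} :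
    emissionProb T i x = 0 ↔ ∀ j, T x i j = 0 := by
  simp [emissionProb, Finset.sum_eq_zero_iff_of_nonneg fun j _ => hT x i j]

lemma sum_sqrt_transition {T : X → Matrix S S ℝ} (hU : Unifilar T) (hT : HMMNonneg T)
    (x : X) (i : S) : ∑ j, √(T x i j) = √(emissionProb T i x) := by
  rcases (emissionProb_nonneg hT i x).eq_or_lt with h | h
  · have h0 := (emissionProb_eq_zero_iff hT).1 h.symm
    rw [← h]
    simp [h0]
  · obtain ⟨j, hj⟩ := exists_pos_of_emissionProb_pos h
    rw [emissionProb_eq hU hT hj]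
    refine Finset.sum_eq_single_of_mem j (Finset.mem_univ j) fun k _ hk => ?_
    rw [hU.eq_zero_of_ne hT hj hk, Real.sqrt_zero]

lemma stateWordProb_nil [DecidableEq S] (T : X → Matrix S S ℝ) (i : S) :
    stateWordProb T i [] = 1 := by
  simp [stateWordProb, wordMatrix, Matrix.one_apply]

lemma stateWordProb_cons [DecidableEq S] (T : X → Matrix S S ℝ) (i : S) (x : X) (w : List X) :
    stateWordProb T i (x :: w) = ∑ j, T x i j * stateWordProb T j w := by
  simp only [stateWordProb, wordMatrix, List.map_cons, List.prod_cons, Matrix.mul_apply,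
    Finset.mul_sum]
  exact Finset.sum_comm

lemma stateWordProb_singleton [DecidableEq S] (T : X → Matrix S S ℝ) (i : S) (x : X) :
    stateWordProb T i [x] = emissionProb T i x := by
  simp [stateWordProb_cons, stateWordProb_nil, emissionProb]

lemma stateWordProb_cons_of_pos [DecidableEq S] {T : X → Matrix S S ℝ} (hU : Unifilar T)
    (hT : HMMNonneg T) {x : X} {i j : S} (hj : 0 < T x i j) (w : List X) :
    stateWordProb T i (x :: w) = T x i j * stateWordProb T j w := by
  rw [stateWordProb_cons]
  refine Finset.sum_eq_single_of_mem j (Finset.mem_univ j) fun k _ hk => ?_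
  rw [hU.eq_zero_of_ne hT hj hk, zero_mul]

lemma stateWordProb_cons_of_emissionProb_eq_zero [DecidableEq S] {T : X → Matrix S S ℝ}
    (hT : HMMNonneg T) {x : X} {i : S} (h : emissionProb T i x = 0) (w : List X) :
    stateWordProb T i (x :: w) = 0 := by
  simp [stateWordProb_cons, (emissionProb_eq_zero_iff hT).1 h]

/-- The probability of emitting a word from an (unnormalised) distribution over states. -/
noncomputable def mixWordProb [DecidableEq S] (T : X → Matrix S S ℝ) (v : S → ℝ)
    (w : List X) : ℝ := ∑ i, v i * stateWordProb T i w

lemma mixWordProb_nil [DecidableEq S] (T : X → Matrix S S ℝ) (v : S → ℝ) :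
    mixWordProb T v [] = ∑ i, v i := by
  simp [mixWordProb, stateWordProb_nil]

lemma mixWordProb_vecMul [DecidableEq S] (T : X → Matrix S S ℝ) (v : S → ℝ) (x : X)
    (w : List X) : mixWordProb T (Matrix.vecMul v (T x)) w = mixWordProb T v (x :: w) := by
  simp only [mixWordProb, stateWordProb_cons, Matrix.vecMul, dotProduct, Finset.sum_mul,
    Finset.mul_sum]
  rw [Finset.sum_comm]
  simp only [mul_assoc]

lemma mixWordProb_eq_sum_sum [DecidableEq S] (T : X → Matrix S S ℝ) (v : S → ℝ)
    (w : List X) : mixWordProb T v w = ∑ j, ∑ i, v i * wordMatrix T w i j := by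
  rw [Finset.sum_comm]
  simp only [mixWordProb, stateWordProb, Finset.mul_sum]

lemma mixWordProb_smul [DecidableEq S] (T : X → Matrix S S ℝ) (c : ℝ) (v : S → ℝ)
    (w : List X) : mixWordProb T (c • v) w = c * mixWordProb T v w := by
  simp only [mixWordProb, Pi.smul_apply, smul_eq_mul, Finset.mul_sum, mul_assoc]

lemma vecMul_nonneg {T : X → Matrix S S ℝ} (hT : HMMNonneg T) {v : S → ℝ} (hv : ∀ i, 0 ≤ v i)
    (x : X) (j : S) : 0 ≤ Matrix.vecMul v (T x) j :=
  Finset.sum_nonneg fun i _ => mul_nonneg (hv i) (hT x i j)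

lemma vecMul_pos {T : X → Matrix S S ℝ} (hT : HMMNonneg T) {v : S → ℝ} (hv : ∀ i, 0 ≤ v i)
    {x : X} {i j : S} (hi : 0 < v i) (hij : 0 < T x i j) : 0 < Matrix.vecMul v (T x) j :=
  Finset.sum_pos' (fun k _ => mul_nonneg (hv k) (hT x k j))
    ⟨i, Finset.mem_univ i, mul_pos hi hij⟩

lemma sum_vecMul [Fintype X] {T : X → Matrix S S ℝ} (hS : HMMStochastic T) (v : S → ℝ) :
    ∑ x, ∑ j, Matrix.vecMul v (T x) j = ∑ i, v i := by
  calc ∑ x, ∑ j, Matrix.vecMul v (T x) j = ∑ x, ∑ i, v i * ∑ j, T x i j := by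
        refine Finset.sum_congr rfl fun x _ => ?_
        simp only [Matrix.vecMul, dotProduct, Finset.mul_sum]
        exact Finset.sum_comm
    _ = ∑ i, v i := by
        rw [Finset.sum_comm]
        refine Finset.sum_congr rfl fun i _ => ?_
        rw [← Finset.mul_sum, hS i, mul_one]

/-- The square of the sum of the square roots of the entries: a homogeneous function of degree
one that measures how spread out a distribution over states is. -/
noncomputable def spread (v : S → ℝ) : ℝ := (∑ i, √(v i)) ^ 2

lemma continuous_spread : Continuous (spread : (S → ℝ) → ℝ) := by
  unfold spread
  fun_prop

lemma spread_smul {c : ℝ} (hc : 0 ≤ c) (v : S → ℝ) : spread (c • v) = c * spread v := by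
  simp only [spread, Pi.smul_apply, smul_eq_mul, Real.sqrt_mul hc, ← Finset.mul_sum, mul_pow,
    Real.sq_sqrt hc]

lemma sqrt_sum_le_sum_sqrt {ι : Type*} (s : Finset ι) {f : ι → ℝ} (hf : ∀ i, 0 ≤ f i) :
    √(∑ i ∈ s, f i) ≤ ∑ i ∈ s, √(f i) := by
  rw [Real.sqrt_le_left (Finset.sum_nonneg fun i _ => Real.sqrt_nonneg _)]
  calc ∑ i ∈ s, f i = ∑ i ∈ s, √(f i) ^ 2 :=
        Finset.sum_congr rfl fun i _ => (Real.sq_sqrt (hf i)).symm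
    _ ≤ (∑ i ∈ s, √(f i)) ^ 2 :=
        Finset.sum_sq_le_sq_sum_of_nonneg fun i _ => Real.sqrt_nonneg _

lemma spread_vecMul_le {T : X → Matrix S S ℝ} (hU : Unifilar T) (hT : HMMNonneg T) {v : S → ℝ}
    (hv : ∀ i, 0 ≤ v i) (x : X) :
    spread (Matrix.vecMul v (T x)) ≤ (∑ i, √(v i) * √(emissionProb T i x)) ^ 2 := by
  refine pow_le_pow_left₀ (Finset.sum_nonneg fun i _ => Real.sqrt_nonneg _) ?_ 2
  calc ∑ j, √(Matrix.vecMul v (T x) j) ≤ ∑ j, ∑ i, √(v i * T x i j) :=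
        Finset.sum_le_sum fun j _ =>
          sqrt_sum_le_sum_sqrt _ fun i => mul_nonneg (hv i) (hT x i j)
    _ = ∑ i, √(v i) * √(emissionProb T i x) := by
        rw [Finset.sum_comm]
        refine Finset.sum_congr rfl fun i _ => ?_
        simp only [← sum_sqrt_transition hU hT, Finset.mul_sum, Real.sqrt_mul (hv i)]

lemma sum_sq_sqrt_sub_sqrt [Fintype X] {T : X → Matrix S S ℝ} (hT : HMMNonneg T)
    (hS : HMMStochastic T) (i j : S) :
    ∑ x, (√(emissionProb T i x) - √(emissionProb T j x)) ^ 2 =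
      2 - 2 * ∑ x, √(emissionProb T i x) * √(emissionProb T j x) := by
  have h1 : ∀ k, ∑ x, √(emissionProb T k x) ^ 2 = 1 := fun k => by
    rw [← hS k]
    exact Finset.sum_congr rfl fun x _ => Real.sq_sqrt (emissionProb_nonneg hT k x)
  simp only [sub_sq, Finset.sum_add_distrib, Finset.sum_sub_distrib, h1, mul_assoc,
    ← Finset.mul_sum]
  ring

/-- Observing a symbol does not increase the expected spread, and the decrease is bounded below
in terms of the Hellinger distances between the emission distributions of the states. -/
lemma sum_spread_vecMul_add_le [Fintype X] {T : X → Matrix S S ℝ} (hU : Unifilar T)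
    (hT : HMMNonneg T) (hS : HMMStochastic T) {v : S → ℝ} (hv : ∀ i, 0 ≤ v i) :
    ∑ x, spread (Matrix.vecMul v (T x)) +
      2⁻¹ * ∑ i, ∑ j, √(v i) * √(v j) *
        ∑ x, (√(emissionProb T i x) - √(emissionProb T j x)) ^ 2 ≤ spread v := by
  have h2 : ∑ x, (∑ i, √(v i) * √(emissionProb T i x)) ^ 2 =
      ∑ i, ∑ j, √(v i) * √(v j) * ∑ x, √(emissionProb T i x) * √(emissionProb T j x) := by
    simp only [sq, Finset.sum_mul_sum]
    simp only [Finset.mul_sum]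
    rw [Finset.sum_comm]
    refine Finset.sum_congr rfl fun i _ => ?_
    rw [Finset.sum_comm]
    refine Finset.sum_congr rfl fun j _ => Finset.sum_congr rfl fun x _ => ?_
    ring
  have h3 : spread v = ∑ i, ∑ j, √(v i) * √(v j) := by
    simp only [spread, sq, Finset.sum_mul_sum]
  have h4 := Finset.sum_le_sum fun x (_ : x ∈ Finset.univ) => spread_vecMul_le hU hT hv x
  rw [h2] at h4
  refine (add_le_add_left h4 _).trans (le_of_eq ?_)
  rw [h3, Finset.mul_sum, ← Finset.sum_add_distrib]
  refine Finset.sum_congr rfl fun i _ => ?_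
  rw [Finset.mul_sum, ← Finset.sum_add_distrib]
  refine Finset.sum_congr rfl fun j _ => ?_
  rw [sum_sq_sqrt_sub_sqrt hT hS]
  ring

lemma sum_spread_vecMul_le [Fintype X] {T : X → Matrix S S ℝ} (hU : Unifilar T)
    (hT : HMMNonneg T) (hS : HMMStochastic T) {v : S → ℝ} (hv : ∀ i, 0 ≤ v i) :
    ∑ x, spread (Matrix.vecMul v (T x)) ≤ spread v :=
  le_trans (le_add_of_nonneg_right (by positivity)) (sum_spread_vecMul_add_le hU hT hS hv)

lemma emissionProb_eq_of_spread_le [Fintype X] {T : X → Matrix S S ℝ} (hU : Unifilar T)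
    (hT : HMMNonneg T) (hS : HMMStochastic T) {v : S → ℝ} (hv : ∀ i, 0 ≤ v i)
    (hle : spread v ≤ ∑ x, spread (Matrix.vecMul v (T x))) {i j : S} (hi : 0 < v i)
    (hj : 0 < v j) (x : X) : emissionProb T i x = emissionProb T j x := by
  by_contra hne
  have hsq : √(emissionProb T i x) - √(emissionProb T j x) ≠ 0 := fun h =>
    hne ((Real.sqrt_inj (emissionProb_nonneg hT i x) (emissionProb_nonneg hT j x)).1
      (sub_eq_zero.1 h))
  have hx : 0 < ∑ x, (√(emissionProb T i x) - √(emissionProb T j x)) ^ 2 :=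
    Finset.sum_pos' (fun _ _ => sq_nonneg _) ⟨x, Finset.mem_univ x, by positivity⟩
  have hpos : 0 < ∑ i, ∑ j, √(v i) * √(v j) *
      ∑ x, (√(emissionProb T i x) - √(emissionProb T j x)) ^ 2 := by
    refine Finset.sum_pos' (fun _ _ => by positivity) ⟨i, Finset.mem_univ i, ?_⟩
    exact Finset.sum_pos' (fun _ _ => by positivity) ⟨j, Finset.mem_univ j, by positivity⟩
  linarith [sum_spread_vecMul_add_le hU hT hS hv]

/-- A property of states that is preserved by transitions holds everywhere in an irreducible HMM
as soon as it holds somewhere. -/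
lemma Irreducible'.forall_of_forall_step [Fintype X] [DecidableEq S] {T : X → Matrix S S ℝ}
    (hI : Irreducible' T) (hT : HMMNonneg T) {p : S → Prop} (hstep : ∀ x i j, p i → 0 < T x i j → p j) {i : S}
    (hi : p i) (j : S) : p j := by
  have key : ∀ n j, 0 < (totalT T ^ n) i j → p j := by
    intro n
    induction n with
    | zero =>
      intro j hj
      rw [pow_zero, Matrix.one_apply] at hj
      split_ifs at hj with h
      · exact h ▸ hi
      · exact absurd hj (lt_irrefl _)
    | succ n ih =>
      intro j hj
      rw [pow_succ, Matrix.mul_apply] at hj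
      obtain ⟨k, hk⟩ := exists_pos_of_sum_pos hj
      have hTk : 0 ≤ totalT T k j := by
        rw [totalT, Matrix.sum_apply]
        exact Finset.sum_nonneg fun x _ => hT x k j
      have hpos : 0 < (totalT T ^ n) i k := pos_of_mul_pos_left hk hTk
      have hkj : 0 < totalT T k j := (pos_iff_pos_of_mul_pos hk).1 hpos
      rw [totalT, Matrix.sum_apply] at hkj
      obtain ⟨x, hx⟩ := exists_pos_of_sum_pos hkj
      exact hstep x k j (ih k hpos) hx
  obtain ⟨n, -, hn⟩ := hI i j
  exact key n j hn

end SingleMachine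

section TwoMachines

variable {X S₁ S₂ : Type*} [Fintype S₁] [DecidableEq S₁] [Fintype S₂] [DecidableEq S₂]

/-- The pairs of unnormalised distributions over the states of two machines that assign the same
probability to every word. -/
def equivCone (T₁ : X → Matrix S₁ S₁ ℝ) (T₂ : X → Matrix S₂ S₂ ℝ) :
    Set ((S₁ → ℝ) × (S₂ → ℝ)) :=
  {q | (∀ i, 0 ≤ q.1 i) ∧ (∀ j, 0 ≤ q.2 j) ∧ ∀ w, mixWordProb T₁ q.1 w = mixWordProb T₂ q.2 w}

variable {T₁ : X → Matrix S₁ S₁ ℝ} {T₂ : X → Matrix S₂ S₂ ℝ}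

lemma isClosed_equivCone : IsClosed (equivCone T₁ T₂) := by
  have h : equivCone T₁ T₂ = {q | ∀ i, 0 ≤ q.1 i} ∩ ({q | ∀ j, 0 ≤ q.2 j} ∩
      {q | ∀ w, mixWordProb T₁ q.1 w = mixWordProb T₂ q.2 w}) := rfl
  rw [h]
  simp only [Set.ofPred_forall, mixWordProb]
  refine (isClosed_iInter fun i => isClosed_le (by fun_prop) (by fun_prop)).inter
    ((isClosed_iInter fun i => isClosed_le (by fun_prop) (by fun_prop)).inter
      (isClosed_iInter fun w => isClosed_eq (by fun_prop) (by fun_prop)))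

lemma sum_fst_eq_sum_snd {q : (S₁ → ℝ) × (S₂ → ℝ)} (hq : q ∈ equivCone T₁ T₂) :
    ∑ i, q.1 i = ∑ j, q.2 j := by
  simpa only [mixWordProb_nil] using hq.2.2 []

lemma smul_mem_equivCone {c : ℝ} (hc : 0 ≤ c) {q : (S₁ → ℝ) × (S₂ → ℝ)}
    (hq : q ∈ equivCone T₁ T₂) : c • q ∈ equivCone T₁ T₂ :=
  ⟨fun i => mul_nonneg hc (hq.1 i), fun j => mul_nonneg hc (hq.2.1 j), fun w => by
    simp only [Prod.smul_fst, Prod.smul_snd, mixWordProb_smul, hq.2.2 w]⟩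

lemma vecMul_mem_equivCone (hT₁ : HMMNonneg T₁) (hT₂ : HMMNonneg T₂)
    {q : (S₁ → ℝ) × (S₂ → ℝ)} (hq : q ∈ equivCone T₁ T₂) (x : X) :
    (Matrix.vecMul q.1 (T₁ x), Matrix.vecMul q.2 (T₂ x)) ∈ equivCone T₁ T₂ :=
  ⟨vecMul_nonneg hT₁ hq.1 x, vecMul_nonneg hT₂ hq.2.1 x, fun w => by
    simp only [mixWordProb_vecMul, hq.2.2]⟩

lemma isCompact_equivCone_inter :
    IsCompact (equivCone T₁ T₂ ∩ {q | ∑ i, q.1 i = 1}) := by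
  refine (isCompact_Icc (a := (0 : (S₁ → ℝ) × (S₂ → ℝ))) (b := 1)).of_isClosed_subset
    (isClosed_equivCone.inter (isClosed_eq (by fun_prop) (by fun_prop))) ?_
  rintro q ⟨hq, hq1 : ∑ i, q.1 i = 1⟩
  have hq2 := (sum_fst_eq_sum_snd hq).symm.trans hq1
  refine ⟨⟨hq.1, hq.2.1⟩, ⟨fun i => ?_, fun j => ?_⟩⟩
  · exact le_of_le_of_eq (Finset.single_le_sum (fun i _ => hq.1 i) (Finset.mem_univ i)) hq1
  · exact le_of_le_of_eq (Finset.single_le_sum (fun j _ => hq.2.1 j) (Finset.mem_univ j)) hq2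

/-- The total spread, relative to the total mass, is minimised on the cone. -/
lemma exists_min_spread {q₀ : (S₁ → ℝ) × (S₂ → ℝ)} (hq₀ : q₀ ∈ equivCone T₁ T₂)
    (hsum : ∑ i, q₀.1 i = 1) :
    ∃ q ∈ equivCone T₁ T₂, ∑ i, q.1 i = 1 ∧ ∀ r ∈ equivCone T₁ T₂,
      (spread q.1 + spread q.2) * ∑ i, r.1 i ≤ spread r.1 + spread r.2 := by
  obtain ⟨q, ⟨hq, hq1⟩, hmin⟩ := (isCompact_equivCone_inter (T₁ := T₁) (T₂ := T₂)).exists_isMinOn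
    ⟨q₀, hq₀, hsum⟩ (f := fun q => spread q.1 + spread q.2)
    (((continuous_spread.comp continuous_fst).add
      (continuous_spread.comp continuous_snd)).continuousOn)
  refine ⟨q, hq, hq1, fun r hr => ?_⟩
  rcases (Finset.sum_nonneg fun i (_ : i ∈ Finset.univ) => hr.1 i).eq_or_lt with h | h
  · rw [← h, mul_zero]
    exact add_nonneg (sq_nonneg _) (sq_nonneg _)
  · have hc := (inv_pos.2 h).le
    have hle : spread q.1 + spread q.2 ≤
        spread ((∑ i, r.1 i)⁻¹ • r.1) + spread ((∑ i, r.1 i)⁻¹ • r.2) := by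
      refine hmin (a := (∑ i, r.1 i)⁻¹ • r) ⟨smul_mem_equivCone hc hr, ?_⟩
      simp [← Finset.mul_sum, inv_mul_cancel₀ h.ne']
    rw [spread_smul hc, spread_smul hc, ← mul_add, inv_mul_eq_div, le_div_iff₀ h] at hle
    exact hle

lemma stateWordProb_eq_of_step {S : Type*} [Fintype S] [DecidableEq S] {T : X → Matrix S S ℝ}
    (hU : Unifilar T) (hT : HMMNonneg T) {v : S → ℝ} (hv : ∀ i, 0 ≤ v i) {x : X} {w : List X}
    (hw : ∀ i j, 0 < Matrix.vecMul v (T x) i → 0 < Matrix.vecMul v (T x) j →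
      stateWordProb T i w = stateWordProb T j w)
    {i j : S} (hi : 0 < v i) (hj : 0 < v j) (hx : emissionProb T i x = emissionProb T j x) :
    stateWordProb T i (x :: w) = stateWordProb T j (x :: w) := by
  rcases (emissionProb_nonneg hT i x).eq_or_lt with h | h
  · rw [stateWordProb_cons_of_emissionProb_eq_zero hT h.symm,
      stateWordProb_cons_of_emissionProb_eq_zero hT (hx.symm.trans h.symm)]
  · obtain ⟨k, hk⟩ := exists_pos_of_emissionProb_pos h
    obtain ⟨l, hl⟩ := exists_pos_of_emissionProb_pos (hx ▸ h)
    rw [stateWordProb_cons_of_pos hU hT hk, stateWordProb_cons_of_pos hU hT hl,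
      ← emissionProb_eq hU hT hk, ← emissionProb_eq hU hT hl, hx,
      hw k l (vecMul_pos hT hv hi hk) (vecMul_pos hT hv hj hl)]

/-- At a pair of minimal total spread, all states in the support of either component emit every
word with the same probability. -/
lemma stateWordProb_eq_of_min_spread [Fintype X] (hU₁ : Unifilar T₁) (hT₁ : HMMNonneg T₁)
    (hS₁ : HMMStochastic T₁) (hU₂ : Unifilar T₂) (hT₂ : HMMNonneg T₂) (hS₂ : HMMStochastic T₂)
    {m : ℝ} (hm : ∀ r ∈ equivCone T₁ T₂, m * ∑ i, r.1 i ≤ spread r.1 + spread r.2)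
    (w : List X) {q : (S₁ → ℝ) × (S₂ → ℝ)} (hq : q ∈ equivCone T₁ T₂)
    (hqm : spread q.1 + spread q.2 ≤ m * ∑ i, q.1 i) :
    (∀ i j, 0 < q.1 i → 0 < q.1 j → stateWordProb T₁ i w = stateWordProb T₁ j w) ∧
    (∀ i j, 0 < q.2 i → 0 < q.2 j → stateWordProb T₂ i w = stateWordProb T₂ j w) := by
  induction w generalizing q with
  | nil => simp [stateWordProb_nil]
  | cons x w ih =>
    have hstep := fun y => hm _ (vecMul_mem_equivCone hT₁ hT₂ hq y)
    have hle₁ := sum_spread_vecMul_le hU₁ hT₁ hS₁ hq.1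
    have hle₂ := sum_spread_vecMul_le hU₂ hT₂ hS₂ hq.2.1
    have hmass : ∑ y, m * ∑ j, Matrix.vecMul q.1 (T₁ y) j = m * ∑ i, q.1 i := by
      rw [← Finset.mul_sum, sum_vecMul hS₁]
    have hsum := Finset.sum_le_sum fun y (_ : y ∈ Finset.univ) => hstep y
    simp only [hmass, Finset.sum_add_distrib] at hsum
    have heq : ∑ y, m * ∑ j, Matrix.vecMul q.1 (T₁ y) j =
        ∑ y, (spread (Matrix.vecMul q.1 (T₁ y)) + spread (Matrix.vecMul q.2 (T₂ y))) := by
      rw [hmass, Finset.sum_add_distrib]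
      linarith
    have hx := (Finset.sum_eq_sum_iff_of_le fun y _ => hstep y).1 heq x (Finset.mem_univ x)
    obtain ⟨h1, h2⟩ := ih (vecMul_mem_equivCone hT₁ hT₂ hq x) hx.ge
    exact ⟨fun i j hi hj => stateWordProb_eq_of_step hU₁ hT₁ hq.1 h1 hi hj
        (emissionProb_eq_of_spread_le hU₁ hT₁ hS₁ hq.1 (by linarith) hi hj x),
      fun i j hi hj => stateWordProb_eq_of_step hU₂ hT₂ hq.2.1 h2 hi hj
        (emissionProb_eq_of_spread_le hU₂ hT₂ hS₂ hq.2.1 (by linarith) hi hj x)⟩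

lemma mixWordProb_eq_stateWordProb {S : Type*} [Fintype S] [DecidableEq S]
    {T : X → Matrix S S ℝ} {v : S → ℝ} (hv : ∀ i, 0 ≤ v i) (hsum : ∑ i, v i = 1) {w : List X}
    {i : S} (h : ∀ j, 0 < v j → stateWordProb T j w = stateWordProb T i w) :
    mixWordProb T v w = stateWordProb T i w := by
  rw [← one_mul (stateWordProb T i w), ← hsum, Finset.sum_mul]
  refine Finset.sum_congr rfl fun j _ => ?_
  rcases (hv j).eq_or_lt with hj | hj
  · rw [← hj, zero_mul, zero_mul]
  · rw [h j hj]

/-- States of two machines are equivalent if they emit every word with the same probability. -/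
def StateEquiv (T₁ : X → Matrix S₁ S₁ ℝ) (T₂ : X → Matrix S₂ S₂ ℝ) (i : S₁) (j : S₂) : Prop :=
  ∀ w, stateWordProb T₁ i w = stateWordProb T₂ j w

lemma StateEquiv.symm {i : S₁} {j : S₂} (h : StateEquiv T₁ T₂ i j) : StateEquiv T₂ T₁ j i :=
  fun w => (h w).symm

lemma exists_stateEquiv [Fintype X] (hU₁ : Unifilar T₁) (hT₁ : HMMNonneg T₁)
    (hS₁ : HMMStochastic T₁) (hU₂ : Unifilar T₂) (hT₂ : HMMNonneg T₂) (hS₂ : HMMStochastic T₂)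
    {q₀ : (S₁ → ℝ) × (S₂ → ℝ)} (hq₀ : q₀ ∈ equivCone T₁ T₂) (hsum : ∑ i, q₀.1 i = 1) :
    ∃ i j, StateEquiv T₁ T₂ i j := by
  obtain ⟨q, hq, hq1, hmin⟩ := exists_min_spread hq₀ hsum
  have hq2 := (sum_fst_eq_sum_snd hq).symm.trans hq1
  obtain ⟨i, hi⟩ := exists_pos_of_sum_pos (hq1 ▸ one_pos)
  obtain ⟨j, hj⟩ := exists_pos_of_sum_pos (hq2 ▸ one_pos)
  refine ⟨i, j, fun w => ?_⟩
  obtain ⟨h1, h2⟩ := stateWordProb_eq_of_min_spread hU₁ hT₁ hS₁ hU₂ hT₂ hS₂ hmin w hq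
    (by rw [hq1, mul_one])
  rw [← mixWordProb_eq_stateWordProb hq.1 hq1 fun k hk => h1 k i hk hi,
    ← mixWordProb_eq_stateWordProb hq.2.1 hq2 fun k hk => h2 k j hk hj, hq.2.2]

lemma StateEquiv.exists_step (hU₁ : Unifilar T₁) (hT₁ : HMMNonneg T₁) (hU₂ : Unifilar T₂)
    (hT₂ : HMMNonneg T₂) {i : S₁} {j : S₂} (h : StateEquiv T₁ T₂ i j) {x : X} {i' : S₁}
    (hi : 0 < T₁ x i i') : ∃ j', T₂ x j j' = T₁ x i i' ∧ StateEquiv T₁ T₂ i' j' := by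
  have hx := h [x]
  rw [stateWordProb_singleton, stateWordProb_singleton, emissionProb_eq hU₁ hT₁ hi] at hx
  obtain ⟨j', hj⟩ := exists_pos_of_emissionProb_pos (hx ▸ hi)
  rw [emissionProb_eq hU₂ hT₂ hj] at hx
  refine ⟨j', hx.symm, fun w => ?_⟩
  have hw := h (x :: w)
  rw [stateWordProb_cons_of_pos hU₁ hT₁ hi, stateWordProb_cons_of_pos hU₂ hT₂ hj, hx] at hw
  exact mul_left_cancel₀ hj.ne' hw

lemma StateEquiv.forall_exists [Fintype X] (hU₁ : Unifilar T₁) (hT₁ : HMMNonneg T₁)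
    (hI₁ : Irreducible' T₁) (hU₂ : Unifilar T₂) (hT₂ : HMMNonneg T₂) {i : S₁} {j : S₂}
    (h : StateEquiv T₁ T₂ i j) (k : S₁) : ∃ l, StateEquiv T₁ T₂ k l := by
  refine hI₁.forall_of_forall_step hT₁ (p := fun k => ∃ l, StateEquiv T₁ T₂ k l) ?_ ⟨j, h⟩ k
  rintro x a b ⟨l, hl⟩ hab
  obtain ⟨l', -, hl'⟩ := hl.exists_step hU₁ hT₁ hU₂ hT₂ hab
  exact ⟨l', hl'⟩

lemma StateEquiv.left_unique (hD : ProbDistinct T₁) {i i' : S₁} {j : S₂}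
    (h : StateEquiv T₁ T₂ i j) (h' : StateEquiv T₁ T₂ i' j) : i = i' := by
  by_contra hne
  obtain ⟨w, -, hw⟩ := hD i i' hne
  exact hw ((h w).trans (h' w).symm)

end TwoMachines

/-- Uniqueness of generator ε-machines: two generator ε-machines generating
the same process are isomorphic. -/
theorem generator_unique
    {X : Type*} [Fintype X]
    {S₁ : Type*} [Fintype S₁] [DecidableEq S₁]
    {S₂ : Type*} [Fintype S₂] [DecidableEq S₂]
    (T₁ : X → Matrix S₁ S₁ ℝ) (T₂ : X → Matrix S₂ S₂ ℝ)
    (h₁ : IsGenEM T₁) (h₂ : IsGenEM T₂)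
    (π₁ : S₁ → ℝ) (π₂ : S₂ → ℝ)
    (hπ₁ : IsStationaryDist T₁ π₁) (hπ₂ : IsStationaryDist T₂ π₂)
    (hsame : ∀ w : List X, w ≠ [] →
      ∑ j, ∑ i, π₁ i * wordMatrix T₁ w i j = ∑ j, ∑ i, π₂ i * wordMatrix T₂ w i j) :
    ∃ f : S₁ ≃ S₂, ∀ (x : X) (i j : S₁), T₁ x i j = T₂ x (f i) (f j) := by
  obtain ⟨hT₁, hS₁, hI₁, hU₁, hD₁⟩ := h₁
  obtain ⟨hT₂, hS₂, hI₂, hU₂, hD₂⟩ := h₂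
  have hmem : (π₁, π₂) ∈ equivCone T₁ T₂ := by
    refine ⟨hπ₁.1, hπ₂.1, fun w => ?_⟩
    rcases eq_or_ne w [] with rfl | hw
    · simp only [mixWordProb_nil, hπ₁.2.1, hπ₂.2.1]
    · simpa only [mixWordProb_eq_sum_sum] using hsame w hw
  obtain ⟨i₀, j₀, h₀⟩ := exists_stateEquiv hU₁ hT₁ hS₁ hU₂ hT₂ hS₂ hmem hπ₁.2.1
  choose f hf using h₀.forall_exists hU₁ hT₁ hI₁ hU₂ hT₂
  choose g hg using h₀.symm.forall_exists hU₂ hT₂ hI₂ hU₁ hT₁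
  refine ⟨⟨f, g, fun i => (hg (f i)).symm.left_unique hD₁ (hf i),
    fun j => (hf (g j)).symm.left_unique hD₂ (hg j)⟩, fun x i j => ?_⟩
  change T₁ x i j = T₂ x (f i) (f j)
  rcases (hT₁ x i j).eq_or_lt with h | h
  · rcases (hT₂ x (f i) (f j)).eq_or_lt with h' | h'
    · rw [← h, ← h']
    · obtain ⟨k, hk, hkj⟩ := (hf i).symm.exists_step hU₂ hT₂ hU₁ hT₁ h'
      rw [← hk, hkj.symm.left_unique hD₁ (hf j)]
  · obtain ⟨l, hl, hlj⟩ := (hf i).exists_step hU₁ hT₁ hU₂ hT₂ h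
    rw [← hl, hlj.symm.left_unique hD₂ (hf j).symm]

end EM
end

section
/- Let ℙ be a finitely characterized, stationary, ergodic process over a finite alphabet 𝒳 with positive-probability predictive equivalence classes E_1,…,E_N. Then its history ε-machine M_h = ({E_1,…,E_N}, 𝒳, {T^(x)}) is a generator ε-machine: it is unifilar, has probabilistically distinct states, and its transition graph is strongly connected; its unique stationary distribution is μ = (ℙ^-(E_1),…,ℙ^-(E_N)); and M_h generates the original process, i.e. ℙ(w) = ‖μ T^(w)‖₁ for every word w ∈ 𝒳*. -/
open MeasureTheory Filter Topology
open scoped Classical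

namespace EM

variable {X : Type*}

/-- The word of length `n` read off `ω` from position `a` on. -/
def window (ω : ℤ → X) (a : ℤ) (n : ℕ) : List X :=
  (List.range n).map fun k : ℕ => ω (a + k)

/-- The event that the word `w` occurs at position `0`. -/
def futureSet (w : List X) : Set (ℤ → X) := {ω | window ω 0 w.length = w}

/-- The last `t` symbols of a past, as a finite tuple. -/
def pastTuple (t : ℕ) (q : ℕ → X) : Fin t → X := fun k => q k

@[simp] lemma length_window (ω : ℤ → X) (a : ℤ) (n : ℕ) : (window ω a n).length = n := by
  simp [window]

lemma window_add (ω : ℤ → X) (a : ℤ) (m n : ℕ) :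
    window ω a (m + n) = window ω a m ++ window ω (a + m) n := by
  simp [window, List.range_add, add_assoc]

lemma window_shift_iterate (ω : ℤ → X) (a : ℤ) (m n : ℕ) :
    window (shift^[m] ω) a n = window ω (a + m) n := by
  induction m generalizing ω with
  | zero => simp
  | succ m ih =>
    rw [Function.iterate_succ_apply, ih]
    simp only [window, shift]
    refine List.map_congr_left fun k _ => ?_
    congr 1
    push_cast
    ring

lemma pastWord_pastMap (ω : ℤ → X) (t : ℕ) : pastWord (pastMap ω) t = window ω (-t) t := by
  apply List.ext_getElem
  · simp [pastWord]
  · intro k h₁ h₂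
    simp only [length_window] at h₂
    simp only [pastWord, window, pastMap, List.getElem_map, List.getElem_reverse,
      List.getElem_range, List.length_range]
    congr 1
    omega

lemma pastWord_eq_reverse_ofFn (q : ℕ → X) (t : ℕ) :
    pastWord q t = (List.ofFn (pastTuple t q)).reverse := by
  rw [pastWord, List.map_reverse]
  congr 1
  apply List.ext_getElem <;> simp [pastTuple]

lemma pastWord_eq_iff (q : ℕ → X) (t : ℕ) (v : Fin t → X) :
    pastWord q t = (List.ofFn v).reverse ↔ pastTuple t q = v := by
  rw [pastWord_eq_reverse_ofFn, List.reverse_inj]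
  exact List.ofFn_injective.eq_iff

lemma pastWord_extendPast (q : ℕ → X) (x : X) (t : ℕ) :
    pastWord (extendPast q x) (t + 1) = pastWord q t ++ [x] := by
  simp only [pastWord, List.range_succ_eq_map, List.reverse_cons, List.map_append,
    List.map_reverse, List.map_map, List.map_cons, List.map_nil]
  rfl

lemma exists_pastWord_eq_append (q : ℕ → X) {s t : ℕ} (h : s ≤ t) :
    ∃ u, pastWord q t = u ++ pastWord q s := by
  obtain ⟨r, rfl⟩ := Nat.exists_eq_add_of_le h
  exact ⟨_, by rw [pastWord, pastWord, List.range_add, List.reverse_append, List.map_append]⟩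

lemma pastMap_shift (ω : ℤ → X) : pastMap (shift ω) = extendPast (pastMap ω) (ω 0) := by
  funext n
  cases n with
  | zero => simp [pastMap, shift, extendPast]
  | succ n =>
    simp only [pastMap, shift, extendPast]
    congr 1

lemma mem_futureSet_singleton (ω : ℤ → X) (x : X) : ω ∈ futureSet [x] ↔ ω 0 = x := by
  simp [futureSet, window, List.range_succ]

lemma futureSet_eq (w : List X) :
    futureSet w = {ω | ∀ k : Fin w.length, ω ((k : ℕ) : ℤ) = w.get k} := by
  ext ω
  refine ⟨fun h k => ?_, fun h => List.ext_getElem (by simp) fun k h₁ h₂ => ?_⟩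
  · have h' : window ω 0 w.length = w := h
    have := List.getElem_of_eq h' (i := k) (by simp)
    simpa [window] using this
  · simpa [window] using h ⟨k, h₂⟩

section Measure

set_option linter.unusedSectionVars false

variable [Fintype X] [MeasurableSpace X] [MeasurableSingletonClass X]
  {μ : Measure (ℤ → X)}

lemma measurable_shift : Measurable (shift (X := X)) :=
  measurable_pi_lambda _ fun n => measurable_pi_apply (n + 1)

lemma measurable_pastMap : Measurable (pastMap (X := X)) :=
  measurable_pi_lambda _ fun n => measurable_pi_apply (-((n : ℤ) + 1))

lemma measurable_pastTuple (t : ℕ) : Measurable (pastTuple (X := X) t) :=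
  measurable_pi_lambda _ fun k => measurable_pi_apply (k : ℕ)

lemma measurableSet_futureSet (w : List X) : MeasurableSet (futureSet w) := by
  rw [futureSet_eq, Set.ofPred_forall]
  exact MeasurableSet.iInter fun k => measurable_pi_apply ((k : ℕ) : ℤ) (measurableSet_singleton _)

lemma measurable_comp_pastWord {α : Type*} [MeasurableSpace α] (f : List X → α) (t : ℕ) :
    Measurable fun q : ℕ → X => f (pastWord q t) := by
  simp_rw [pastWord_eq_reverse_ofFn]
  exact (measurable_of_countable fun v : Fin t → X => f (List.ofFn v).reverse).comp
    (measurable_pastTuple t)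

lemma wordProb_eq (μ : Measure (ℤ → X)) (w : List X) : wordProb μ w = μ.real (futureSet w) := by
  rw [wordProb, futureSet_eq, measureReal_def]

lemma Stationary.measurePreserving (hstat : Stationary μ) : MeasurePreserving shift μ μ :=
  ⟨measurable_shift, hstat⟩

/-- The probability that the past ends in `v` and the future starts with `w`. -/
lemma measureReal_past_inter_future (hstat : Stationary μ) {t : ℕ} (v w : List X)
    (hv : v.length = t) :
    μ.real ({ω | pastWord (pastMap ω) t = v} ∩ futureSet w) = wordProb μ (v ++ w) := by
  subst hv
  rw [wordProb_eq, measureReal_def, measureReal_def,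
    ← (hstat.measurePreserving.iterate v.length).measure_preimage
      (s := {ω | pastWord (pastMap ω) v.length = v} ∩ futureSet w)]
  · congr 2
    ext ω
    simp only [Set.mem_preimage, Set.mem_inter_iff, Set.mem_ofPred_eq, futureSet,
      pastWord_pastMap, window_shift_iterate, List.length_append, window_add, neg_add_cancel,
      zero_add]
    exact ⟨fun h => by rw [h.1, h.2], fun h => List.append_inj h (by simp)⟩
  · refine (MeasurableSet.inter ?_ (measurableSet_futureSet w)).nullMeasurableSet
    exact ((measurable_comp_pastWord (fun u => u = v) v.length).comp measurable_pastMap).setOf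

lemma wordProb_nonneg (μ : Measure (ℤ → X)) (w : List X) : 0 ≤ wordProb μ w :=
  ENNReal.toReal_nonneg

variable [IsProbabilityMeasure μ]

lemma wordProb_append_le_right (hstat : Stationary μ) (v w : List X) :
    wordProb μ (v ++ w) ≤ wordProb μ w := by
  rw [← measureReal_past_inter_future hstat v w rfl, wordProb_eq]
  exact measureReal_mono Set.inter_subset_right

lemma futureSet_nil : futureSet ([] : List X) = Set.univ := by
  ext; simp [futureSet, window]

lemma wordProb_append_le_left (hstat : Stationary μ) (v w : List X) :
    wordProb μ (v ++ w) ≤ wordProb μ v := by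
  have h := measureReal_past_inter_future hstat v [] rfl
  rw [List.append_nil] at h
  rw [← measureReal_past_inter_future hstat v w rfl, ← h, futureSet_nil, Set.inter_univ]
  exact measureReal_mono Set.inter_subset_left

lemma condProb_nonneg (μ : Measure (ℤ → X)) (w v : List X) : 0 ≤ condProb μ w v :=
  div_nonneg (wordProb_nonneg μ _) (wordProb_nonneg μ _)

lemma condProb_le_one (hstat : Stationary μ) (w v : List X) : condProb μ w v ≤ 1 :=
  div_le_one_of_le₀ (wordProb_append_le_left hstat v w) (wordProb_nonneg μ v)

lemma condProb_mul_wordProb (hstat : Stationary μ) (w v : List X) :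
    condProb μ w v * wordProb μ v = wordProb μ (v ++ w) := by
  by_cases h : wordProb μ v = 0
  · rw [h, mul_zero]
    exact le_antisymm (wordProb_nonneg μ _) (h ▸ wordProb_append_le_left hstat v w)
  · exact div_mul_cancel₀ _ h

lemma condProb_cons (hstat : Stationary μ) (x : X) (w v : List X) :
    condProb μ (x :: w) v = condProb μ [x] v * condProb μ w (v ++ [x]) := by
  have h := condProb_mul_wordProb hstat w (v ++ [x])
  rw [List.append_assoc, List.singleton_append] at h
  rw [show condProb μ (x :: w) v = wordProb μ (v ++ x :: w) / wordProb μ v from rfl, ← h,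
    show condProb μ [x] v = wordProb μ (v ++ [x]) / wordProb μ v from rfl]
  ring

/-! ### Regular pasts -/

lemma tendsto_condProb_nil {q : ℕ → X} (h : Nontrivial' μ q) :
    Tendsto (fun t => condProb μ [] (pastWord q t)) atTop (𝓝 1) := by
  have (t : ℕ) : condProb μ [] (pastWord q t) = 1 := by
    rw [condProb, List.append_nil, div_self (h t).ne']
  simp [this]

lemma Regular.tendsto {q : ℕ → X} (h : Regular μ q) (w : List X) :
    Tendsto (fun t => condProb μ w (pastWord q t)) atTop (𝓝 (predProb μ q w)) := by
  apply tendsto_nhds_limUnder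
  by_cases hw : w = []
  · exact hw ▸ ⟨1, tendsto_condProb_nil h.1⟩
  · exact h.2 w hw

lemma Regular.predProb_nonneg {q : ℕ → X} (h : Regular μ q) (w : List X) :
    0 ≤ predProb μ q w :=
  ge_of_tendsto' (h.tendsto w) fun _ => condProb_nonneg μ _ _

lemma Regular.predProb_nil {q : ℕ → X} (h : Regular μ q) : predProb μ q [] = 1 :=
  tendsto_nhds_unique (h.tendsto []) (tendsto_condProb_nil h.1)

lemma predProb_eq_of_mem_classOf {p q : ℕ → X} (hp : Regular μ p) (h : q ∈ classOf μ p)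
    (w : List X) : predProb μ q w = predProb μ p w := by
  by_cases hw : w = []
  · rw [hw, hp.predProb_nil, h.1.predProb_nil]
  · exact h.2 w hw

lemma mem_classOf_self {p : ℕ → X} (hp : Regular μ p) : p ∈ classOf μ p :=
  ⟨hp, fun _ _ => rfl⟩

lemma classOf_eq_of_mem {p q : ℕ → X} (h : q ∈ classOf μ p) : classOf μ q = classOf μ p := by
  ext r
  exact ⟨fun hr => ⟨hr.1, fun w hw => (hr.2 w hw).trans (h.2 w hw)⟩,
    fun hr => ⟨hr.1, fun w hw => (hr.2 w hw).trans (h.2 w hw).symm⟩⟩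

lemma classOf_eq_setOf_tendsto (p : ℕ → X) :
    classOf μ p = {q | Nontrivial' μ q} ∩ ⋂ w : List X, ⋂ _ : w ≠ [],
      {q | Tendsto (fun t => condProb μ w (pastWord q t)) atTop (𝓝 (predProb μ p w))} := by
  ext q
  simp only [Set.mem_inter_iff, Set.mem_iInter, Set.mem_ofPred_eq]
  refine ⟨fun h => ⟨h.1.1, fun w hw => h.2 w hw ▸ h.1.tendsto w⟩,
    fun h => ⟨⟨h.1, fun w hw => ⟨_, h.2 w hw⟩⟩, fun w hw => (h.2 w hw).limUnder_eq⟩⟩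

lemma measurableSet_classOf (p : ℕ → X) : MeasurableSet (classOf μ p) := by
  rw [classOf_eq_setOf_tendsto]
  refine MeasurableSet.inter ?_ (MeasurableSet.iInter fun w => MeasurableSet.iInter fun _ =>
    measurableSet_tendsto _ fun t => measurable_comp_pastWord _ t)
  simp only [Nontrivial', Set.ofPred_forall]
  exact MeasurableSet.iInter fun t =>
    measurableSet_lt measurable_const (measurable_comp_pastWord _ t)

lemma nontrivial_extendPast (hstat : Stationary μ) {q : ℕ → X} (hq : Regular μ q) {x : X}
    (hx : 0 < predProb μ q [x]) : Nontrivial' μ (extendPast q x) := by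
  intro t
  obtain ⟨s, hs, hts⟩ :=
    (((hq.tendsto [x]).eventually_const_lt hx).and (eventually_ge_atTop t)).exists
  obtain ⟨u, hu⟩ := exists_pastWord_eq_append (extendPast q x) (hts.trans s.le_succ)
  have hpos : 0 < wordProb μ (pastWord (extendPast q x) (s + 1)) := by
    rw [pastWord_extendPast, ← condProb_mul_wordProb hstat]
    exact mul_pos hs (hq.1 s)
  rw [hu] at hpos
  exact hpos.trans_le (wordProb_append_le_right hstat _ _)

lemma tendsto_condProb_extendPast (hstat : Stationary μ) {q : ℕ → X} (hq : Regular μ q) {x : X}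
    (hx : 0 < predProb μ q [x]) (w : List X) :
    Tendsto (fun t => condProb μ w (pastWord (extendPast q x) t)) atTop
      (𝓝 (predProb μ q (x :: w) / predProb μ q [x])) := by
  rw [← tendsto_add_atTop_iff_nat 1]
  refine ((hq.tendsto (x :: w)).div (hq.tendsto [x]) hx.ne').congr' ?_
  filter_upwards [(hq.tendsto [x]).eventually_const_lt hx] with t ht
  rw [pastWord_extendPast]
  simp only [Pi.div_apply]
  rw [condProb_cons hstat, mul_div_cancel_left₀ _ ht.ne']

lemma regular_extendPast (hstat : Stationary μ) {q : ℕ → X} (hq : Regular μ q) {x : X}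
    (hx : 0 < predProb μ q [x]) : Regular μ (extendPast q x) :=
  ⟨nontrivial_extendPast hstat hq hx, fun w _ => ⟨_, tendsto_condProb_extendPast hstat hq hx w⟩⟩

lemma predProb_extendPast (hstat : Stationary μ) {q : ℕ → X} (hq : Regular μ q) {x : X}
    (hx : 0 < predProb μ q [x]) (w : List X) :
    predProb μ (extendPast q x) w = predProb μ q (x :: w) / predProb μ q [x] :=
  (tendsto_condProb_extendPast hstat hq hx w).limUnder_eq

lemma predProb_cons_eq_zero (hstat : Stationary μ) {q : ℕ → X} (hq : Regular μ q) {x : X}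
    (hx : predProb μ q [x] = 0) (w : List X) : predProb μ q (x :: w) = 0 := by
  refine le_antisymm (hx ▸ le_of_tendsto_of_tendsto' (hq.tendsto _) (hq.tendsto _) fun t => ?_)
    (hq.predProb_nonneg _)
  rw [condProb_cons hstat]
  exact mul_le_of_le_one_right (condProb_nonneg μ _ _) (condProb_le_one hstat _ _)

lemma extendPast_mem_classOf (hstat : Stationary μ) {p q : ℕ → X} (hp : Regular μ p)
    (h : q ∈ classOf μ p) {x : X} (hx : 0 < predProb μ p [x]) :
    extendPast q x ∈ classOf μ (extendPast p x) := by
  have hx' : 0 < predProb μ q [x] := by rwa [predProb_eq_of_mem_classOf hp h]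
  refine ⟨regular_extendPast hstat h.1 hx', fun w _ => ?_⟩
  rw [predProb_extendPast hstat h.1 hx', predProb_extendPast hstat hp hx,
    predProb_eq_of_mem_classOf hp h, predProb_eq_of_mem_classOf hp h]

/-! ### Disintegration of the future along the past -/

lemma exists_pastTuple_preimage {A : Set (ℕ → X)} (hA : A ∈ measurableCylinders fun _ : ℕ => X) :
    ∃ t₀ : ℕ, ∀ t ≥ t₀, ∃ V : Set (Fin t → X), A = pastTuple t ⁻¹' V := by
  obtain ⟨s, S, -, rfl⟩ := (mem_measurableCylinders A).1 hA
  obtain ⟨t₀, ht₀⟩ := s.exists_nat_subset_range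
  refine ⟨t₀, fun t ht => ⟨{v | (fun i : s => v ⟨i, ?_⟩) ∈ S}, rfl⟩⟩
  exact (Finset.mem_range.1 (ht₀ i.2)).trans_le ht

lemma map_pastTuple_eq_withDensity (hstat : Stationary μ) (w : List X) (t : ℕ) :
    ((μ.restrict (futureSet w)).map pastMap).map (pastTuple t) =
      ((pastMeasure μ).map (pastTuple t)).withDensity fun v =>
        ENNReal.ofReal (condProb μ w (List.ofFn v).reverse) := by
  have hset (v : Fin t → X) : pastMap ⁻¹' (pastTuple t ⁻¹' {v}) =
      {ω : ℤ → X | pastWord (pastMap ω) t = (List.ofFn v).reverse} := by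
    ext ω
    exact (pastWord_eq_iff _ _ _).symm
  have hmeas (v : Fin t → X) : MeasurableSet (pastTuple t ⁻¹' {v}) :=
    measurable_pastTuple t (measurableSet_singleton v)
  refine Measure.ext_of_singleton fun v => ?_
  have h₁ := measureReal_past_inter_future hstat (t := t) (List.ofFn v).reverse w (by simp)
  have h₂ := measureReal_past_inter_future hstat (t := t) (List.ofFn v).reverse [] (by simp)
  rw [futureSet_nil, Set.inter_univ, List.append_nil] at h₂
  rw [withDensity_apply _ (measurableSet_singleton v), lintegral_singleton, pastMeasure,
    Measure.map_apply (measurable_pastTuple t) (measurableSet_singleton v),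
    Measure.map_apply (measurable_pastTuple t) (measurableSet_singleton v),
    Measure.map_apply measurable_pastMap (hmeas v), Measure.map_apply measurable_pastMap (hmeas v),
    Measure.restrict_apply (measurable_pastMap (hmeas v)), hset, ← ofReal_measureReal,
    ← ofReal_measureReal, h₁, h₂, ← ENNReal.ofReal_mul (condProb_nonneg μ _ _),
    condProb_mul_wordProb hstat]

lemma map_pastMap_restrict_eq_withDensity (hstat : Stationary μ)
    (hreg : ∀ᵐ q ∂pastMeasure μ, Regular μ q) (w : List X) :
    (μ.restrict (futureSet w)).map pastMap =
      (pastMeasure μ).withDensity fun q => ENNReal.ofReal (predProb μ q w) := by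
  have key : ∀ A ∈ measurableCylinders fun _ : ℕ => X,
      (μ.restrict (futureSet w)).map pastMap A =
        (pastMeasure μ).withDensity (fun q => ENNReal.ofReal (predProb μ q w)) A := by
    intro A hA
    have hAm : MeasurableSet A := MeasurableSet.of_mem_measurableCylinders hA
    have : IsProbabilityMeasure (pastMeasure μ) :=
      Measure.isProbabilityMeasure_map measurable_pastMap.aemeasurable
    obtain ⟨t₀, ht₀⟩ := exists_pastTuple_preimage hA
    rw [withDensity_apply _ hAm]
    have hlim : Tendsto
        (fun t => ∫⁻ q in A, ENNReal.ofReal (condProb μ w (pastWord q t)) ∂pastMeasure μ) atTop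
        (𝓝 (∫⁻ q in A, ENNReal.ofReal (predProb μ q w) ∂pastMeasure μ)) := by
      refine tendsto_lintegral_of_dominated_convergence (fun _ => 1)
        (fun t => (measurable_comp_pastWord _ t).ennreal_ofReal) (fun t => ?_) (by simp) ?_
      · exact Eventually.of_forall fun q => ENNReal.ofReal_le_one.2 (condProb_le_one hstat _ _)
      · filter_upwards [ae_restrict_of_ae hreg] with q hq
        exact ENNReal.tendsto_ofReal (hq.tendsto w)
    refine tendsto_nhds_unique (tendsto_const_nhds.congr' ?_) hlim
    filter_upwards [eventually_ge_atTop t₀] with t ht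
    obtain ⟨V, rfl⟩ := ht₀ t ht
    have hV : MeasurableSet V := V.toFinite.measurableSet
    rw [← Measure.map_apply (measurable_pastTuple t) hV, map_pastTuple_eq_withDensity hstat,
      withDensity_apply _ hV, setLIntegral_map hV (measurable_of_countable _)
        (measurable_pastTuple t)]
    simp_rw [pastWord_eq_reverse_ofFn]
  exact ext_of_generate_finite _ generateFrom_measurableCylinders.symm
    isPiSystem_measurableCylinders key (key _ (univ_mem_measurableCylinders _))

lemma measure_past_mem_classOf_inter_future (hstat : Stationary μ)
    (hreg : ∀ᵐ q ∂pastMeasure μ, Regular μ q) {p : ℕ → X} (hp : Regular μ p) (w : List X) :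
    μ.real (pastMap ⁻¹' classOf μ p ∩ futureSet w) =
      (pastMeasure μ).real (classOf μ p) * predProb μ p w := by
  have hm := measurableSet_classOf (μ := μ) p
  have h := congrArg (fun ρ => ρ (classOf μ p)) (map_pastMap_restrict_eq_withDensity hstat hreg w)
  beta_reduce at h
  rw [Measure.map_apply measurable_pastMap hm, Measure.restrict_apply (measurable_pastMap hm),
    withDensity_apply _ hm, setLIntegral_congr_fun hm (g := fun _ => ENNReal.ofReal (predProb μ p w))
      (fun q hq => by simp only [predProb_eq_of_mem_classOf hp hq]), setLIntegral_const] at h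
  rw [measureReal_def, h, ENNReal.toReal_mul, ENNReal.toReal_ofReal (hp.predProb_nonneg w),
    mul_comm, measureReal_def]

/-! ### The history machine -/

/-- The event that the past belongs to the predictive equivalence class of `p`. -/
def classEvent (μ : Measure (ℤ → X)) (p : ℕ → X) : Set (ℤ → X) := pastMap ⁻¹' classOf μ p

lemma measurableSet_classEvent (p : ℕ → X) : MeasurableSet (classEvent μ p) :=
  measurable_pastMap (measurableSet_classOf p)

lemma pastMeasure_classOf (p : ℕ → X) :
    pastMeasure μ (classOf μ p) = μ (classEvent μ p) :=
  Measure.map_apply measurable_pastMap (measurableSet_classOf p)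

lemma pastMeasure_real_classOf (p : ℕ → X) :
    (pastMeasure μ).real (classOf μ p) = μ.real (classEvent μ p) := by
  rw [measureReal_def, pastMeasure_classOf, measureReal_def]

lemma sum_measureReal_inter {Ω ι : Type*} [MeasurableSpace Ω] [Fintype ι] {ρ : Measure Ω}
    [IsFiniteMeasure ρ] {A : ι → Set Ω} (hA : ∀ i, MeasurableSet (A i))
    (hd : Pairwise (Function.onFun Disjoint A)) (hc : ∀ᵐ ω ∂ρ, ∃ i, ω ∈ A i) {B : Set Ω}
    (hB : MeasurableSet B) : ∑ i, ρ.real (B ∩ A i) = ρ.real B := by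
  rw [← measureReal_iUnion_fintype
    (fun i j hij => (hd hij).mono Set.inter_subset_right Set.inter_subset_right)
    (fun i => hB.inter (hA i))]
  refine measureReal_congr ?_
  filter_upwards [hc] with ω hω
  obtain ⟨i, hi⟩ := hω
  refine propext ⟨fun h => ?_, fun h => Set.mem_iUnion.2 ⟨i, h, hi⟩⟩
  obtain ⟨j, hj⟩ := Set.mem_iUnion.1 h
  exact hj.1

lemma sum_measureReal_inter_futureSet {B : Set (ℤ → X)} (hB : MeasurableSet B) :
    ∑ x, μ.real (B ∩ futureSet [x]) = μ.real B := by
  refine sum_measureReal_inter (fun x => measurableSet_futureSet [x]) (fun x y hxy => ?_)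
    (Eventually.of_forall fun ω => ⟨ω 0, (mem_futureSet_singleton _ _).2 rfl⟩) hB
  refine Set.disjoint_left.2 fun ω h₁ h₂ => hxy ?_
  rw [mem_futureSet_singleton] at h₁ h₂
  exact h₁.symm.trans h₂

section History

variable {N : ℕ} {p : Fin N → (ℕ → X)}

lemma FinitelyCharacterized.pairwise_disjoint (hfc : FinitelyCharacterized μ p) :
    Pairwise (Function.onFun Disjoint fun i => classOf μ (p i)) := fun i j hij =>
  Set.disjoint_left.2 fun _ h₁ h₂ => hfc.2.1 i j hij
    ((classOf_eq_of_mem h₁).symm.trans (classOf_eq_of_mem h₂))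

lemma FinitelyCharacterized.ae_exists_mem_classOf (hfc : FinitelyCharacterized μ p) :
    ∀ᵐ q ∂pastMeasure μ, ∃ i, q ∈ classOf μ (p i) := by
  have : IsProbabilityMeasure (pastMeasure μ) :=
    Measure.isProbabilityMeasure_map measurable_pastMap.aemeasurable
  have hm : MeasurableSet (⋃ i, classOf μ (p i)) :=
    MeasurableSet.iUnion fun i => measurableSet_classOf (p i)
  have h : pastMeasure μ (⋃ i, classOf μ (p i)) = 1 := by
    rw [measure_iUnion hfc.pairwise_disjoint fun i => measurableSet_classOf (p i),
      tsum_fintype, hfc.2.2.2]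
  filter_upwards [(mem_ae_iff_prob_eq_one hm).2 h] with q hq
  exact Set.mem_iUnion.1 hq

lemma FinitelyCharacterized.ae_regular (hfc : FinitelyCharacterized μ p) :
    ∀ᵐ q ∂pastMeasure μ, Regular μ q :=
  hfc.ae_exists_mem_classOf.mono fun _ ⟨_, h⟩ => h.1

lemma FinitelyCharacterized.ae_exists_mem_classEvent (hfc : FinitelyCharacterized μ p) :
    ∀ᵐ ω ∂μ, ∃ i, ω ∈ classEvent μ (p i) :=
  ae_of_ae_map measurable_pastMap.aemeasurable hfc.ae_exists_mem_classOf

lemma FinitelyCharacterized.sum_inter_classEvent (hfc : FinitelyCharacterized μ p)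
    {B : Set (ℤ → X)} (hB : MeasurableSet B) :
    ∑ i, μ.real (B ∩ classEvent μ (p i)) = μ.real B :=
  sum_measureReal_inter (fun i => measurableSet_classEvent (p i))
    (fun _ _ hij => (hfc.pairwise_disjoint hij).preimage _) hfc.ae_exists_mem_classEvent hB

lemma FinitelyCharacterized.sum_inter_preimage_classEvent (hstat : Stationary μ)
    (hfc : FinitelyCharacterized μ p) {B : Set (ℤ → X)} (hB : MeasurableSet B) :
    ∑ i, μ.real (B ∩ shift ⁻¹' classEvent μ (p i)) = μ.real B :=
  sum_measureReal_inter (fun i => measurable_shift (measurableSet_classEvent (p i)))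
    (fun _ _ hij => ((hfc.pairwise_disjoint hij).preimage _).preimage _)
    (hstat.measurePreserving.quasiMeasurePreserving.ae hfc.ae_exists_mem_classEvent) hB

lemma FinitelyCharacterized.measureReal_classEvent_pos (hfc : FinitelyCharacterized μ p)
    (i : Fin N) : 0 < μ.real (classEvent μ (p i)) := by
  rw [measureReal_def, ← pastMeasure_classOf]
  exact ENNReal.toReal_pos (hfc.2.2.1 i).ne' (by rw [pastMeasure_classOf]; finiteness)

lemma FinitelyCharacterized.measureReal_classEvent_inter_futureSet (hstat : Stationary μ)
    (hfc : FinitelyCharacterized μ p) (i : Fin N) (w : List X) :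
    μ.real (classEvent μ (p i) ∩ futureSet w) =
      μ.real (classEvent μ (p i)) * predProb μ (p i) w := by
  rw [← pastMeasure_real_classOf]
  exact measure_past_mem_classOf_inter_future hstat hfc.ae_regular (hfc.1 i) w

lemma FinitelyCharacterized.histT_nonneg (hfc : FinitelyCharacterized μ p) :
    HMMNonneg (histT μ p) := by
  intro x i j
  rw [histT]
  split_ifs
  exacts [(hfc.1 i).predProb_nonneg _, le_rfl]

/-- The joint law of the current state, the emitted symbol and the next state. -/
lemma FinitelyCharacterized.measureReal_transition (hstat : Stationary μ)
    (hfc : FinitelyCharacterized μ p) (x : X) (i j : Fin N) :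
    μ.real (classEvent μ (p i) ∩ futureSet [x] ∩ shift ⁻¹' classEvent μ (p j)) =
      μ.real (classEvent μ (p i)) * histT μ p x i j := by
  have hle := hfc.measureReal_classEvent_inter_futureSet hstat i [x]
  rcases ((hfc.1 i).predProb_nonneg [x]).eq_or_lt with hx | hx
  · rw [histT, if_neg (fun h => h.1.ne hx), mul_zero]
    rw [← hx, mul_zero] at hle
    exact le_antisymm (hle ▸ measureReal_mono Set.inter_subset_left) measureReal_nonneg
  · have hmem : ∀ ω ∈ classEvent μ (p i) ∩ futureSet [x],
        pastMap (shift ω) ∈ classOf μ (extendPast (p i) x) := by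
      rintro ω ⟨h, h₀⟩
      rw [mem_futureSet_singleton] at h₀
      rw [pastMap_shift, h₀]
      exact extendPast_mem_classOf hstat (hfc.1 i) h hx
    by_cases hc : classOf μ (extendPast (p i) x) = classOf μ (p j)
    · rw [histT, if_pos ⟨hx, hc⟩, ← hle, Set.inter_eq_left.2]
      exact fun ω hω => (hc ▸ hmem ω hω : pastMap (shift ω) ∈ classOf μ (p j))
    · rw [histT, if_neg fun h => hc h.2, mul_zero]
      convert measureReal_empty (μ := μ)
      refine Set.eq_empty_of_forall_notMem fun ω hω => hc ?_
      exact (classOf_eq_of_mem (hmem ω hω.1)).symm.trans (classOf_eq_of_mem hω.2)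

lemma FinitelyCharacterized.sum_histT (hstat : Stationary μ)
    (hfc : FinitelyCharacterized μ p) (x : X) (i : Fin N) :
    ∑ j, histT μ p x i j = predProb μ (p i) [x] := by
  refine mul_left_cancel₀ (hfc.measureReal_classEvent_pos i).ne' ?_
  rw [Finset.mul_sum, ← hfc.measureReal_classEvent_inter_futureSet hstat,
    ← hfc.sum_inter_preimage_classEvent hstat
      ((measurableSet_classEvent (p i)).inter (measurableSet_futureSet [x]))]
  exact Finset.sum_congr rfl fun j _ => (hfc.measureReal_transition hstat x i j).symm

lemma FinitelyCharacterized.histT_stochastic (hstat : Stationary μ)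
    (hfc : FinitelyCharacterized μ p) : HMMStochastic (histT μ p) := by
  intro i
  refine mul_left_cancel₀ (hfc.measureReal_classEvent_pos i).ne' ?_
  simp_rw [hfc.sum_histT hstat, Finset.mul_sum, mul_one,
    ← hfc.measureReal_classEvent_inter_futureSet hstat]
  exact sum_measureReal_inter_futureSet (measurableSet_classEvent (p i))

lemma FinitelyCharacterized.histT_unifilar (hfc : FinitelyCharacterized μ p) :
    Unifilar (histT μ p) := by
  intro x i j k hj hk
  by_contra hjk
  have h (l : Fin N) (hl : 0 < histT μ p x i l) :
      classOf μ (extendPast (p i) x) = classOf μ (p l) := by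
    by_contra hc
    rw [histT, if_neg fun h => hc h.2] at hl
    exact hl.false
  exact hfc.2.1 j k hjk ((h j hj).symm.trans (h k hk))

lemma FinitelyCharacterized.measureReal_inter_preimage (hstat : Stationary μ)
    (hfc : FinitelyCharacterized μ p) (i j : Fin N) :
    μ.real (classEvent μ (p i) ∩ shift ⁻¹' classEvent μ (p j)) =
      μ.real (classEvent μ (p i)) * totalT (histT μ p) i j := by
  rw [← sum_measureReal_inter_futureSet
    ((measurableSet_classEvent (p i)).inter (measurable_shift (measurableSet_classEvent (p j)))),
    totalT, Matrix.sum_apply, Finset.mul_sum]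
  refine Finset.sum_congr rfl fun x _ => ?_
  rw [Set.inter_right_comm, hfc.measureReal_transition hstat]

lemma FinitelyCharacterized.isStationaryDist (hstat : Stationary μ)
    (hfc : FinitelyCharacterized μ p) :
    IsStationaryDist (histT μ p) fun i => μ.real (classEvent μ (p i)) := by
  refine ⟨fun i => measureReal_nonneg, ?_, fun j => ?_⟩
  · have h := hfc.sum_inter_classEvent MeasurableSet.univ
    simpa using h
  · simp_rw [← hfc.measureReal_inter_preimage hstat, Set.inter_comm (classEvent _ _)]
    rw [hfc.sum_inter_classEvent (measurable_shift (measurableSet_classEvent (p j))),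
      measureReal_def, hstat.measurePreserving.measure_preimage
        (measurableSet_classEvent (p j)).nullMeasurableSet, measureReal_def]

lemma FinitelyCharacterized.stateWordProb_histT (hstat : Stationary μ)
    (hfc : FinitelyCharacterized μ p) (i : Fin N) (w : List X) :
    stateWordProb (histT μ p) i w = predProb μ (p i) w := by
  induction w generalizing i with
  | nil => simp [stateWordProb, wordMatrix, Matrix.one_apply, (hfc.1 i).predProb_nil]
  | cons x w ih =>
    have hcons : stateWordProb (histT μ p) i (x :: w) =
        ∑ j, histT μ p x i j * predProb μ (p j) w := by
      simp_rw [← ih, stateWordProb, wordMatrix, List.map_cons, List.prod_cons, Matrix.mul_apply,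
        Finset.mul_sum]
      exact Finset.sum_comm
    rw [hcons]
    rcases ((hfc.1 i).predProb_nonneg [x]).eq_or_lt with hx | hx
    · rw [predProb_cons_eq_zero hstat (hfc.1 i) hx.symm]
      refine Finset.sum_eq_zero fun j _ => ?_
      rw [histT, if_neg fun h => h.1.ne hx, zero_mul]
    · have hreg := regular_extendPast hstat (hfc.1 i) hx
      have hj (j : Fin N) : histT μ p x i j * predProb μ (p j) w =
          histT μ p x i j * predProb μ (extendPast (p i) x) w := by
        by_cases hc : classOf μ (extendPast (p i) x) = classOf μ (p j)
        · have hmem : extendPast (p i) x ∈ classOf μ (p j) := hc ▸ mem_classOf_self hreg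
          rw [predProb_eq_of_mem_classOf (hfc.1 j) hmem]
        · rw [histT, if_neg fun h => hc h.2, zero_mul, zero_mul]
      rw [Finset.sum_congr rfl fun j _ => hj j, ← Finset.sum_mul, hfc.sum_histT hstat,
        predProb_extendPast hstat (hfc.1 i) hx, mul_div_cancel₀ _ hx.ne']

lemma FinitelyCharacterized.histT_probDistinct (hstat : Stationary μ)
    (hfc : FinitelyCharacterized μ p) : ProbDistinct (histT μ p) := by
  intro i j hij
  by_contra! h
  refine hfc.2.1 i j hij (classOf_eq_of_mem ⟨hfc.1 i, fun w hw => ?_⟩)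
  rw [← hfc.stateWordProb_histT hstat, ← hfc.stateWordProb_histT hstat, h w hw]

lemma FinitelyCharacterized.wordProb_eq_sum (hstat : Stationary μ)
    (hfc : FinitelyCharacterized μ p) (w : List X) :
    wordProb μ w =
      ∑ j, ∑ i, μ.real (classEvent μ (p i)) * wordMatrix (histT μ p) w i j := by
  rw [Finset.sum_comm, wordProb_eq, ← hfc.sum_inter_classEvent (measurableSet_futureSet w)]
  refine Finset.sum_congr rfl fun i _ => ?_
  rw [← Finset.mul_sum, Set.inter_comm, hfc.measureReal_classEvent_inter_futureSet hstat,
    ← hfc.stateWordProb_histT hstat, stateWordProb]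

end History

lemma Stationary.ergodic (hstat : Stationary μ) (herg : Ergodic' μ) : Ergodic shift μ where
  toMeasurePreserving := hstat.measurePreserving
  aeconst_set A hA hinv := by
    rw [eventuallyConst_set']
    refine (herg A hA hinv).imp (fun h => ae_eq_empty.2 h) fun h => ?_
    exact eventuallyEq_univ.2 ((mem_ae_iff_prob_eq_one hA).2 h)

end Measure

section HMM

variable {S : Type*} [Fintype X] {T : X → Matrix S S ℝ}

lemma totalT_nonneg (hT : HMMNonneg T) (i j : S) : 0 ≤ totalT T i j := by
  rw [totalT, Matrix.sum_apply]
  exact Finset.sum_nonneg fun x _ => hT x i j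

variable [Fintype S]

lemma HMMStochastic.exists_totalT_pos (hT : HMMNonneg T) (hs : HMMStochastic T) (i : S) :
    ∃ j, 0 < totalT T i j := by
  by_contra! h
  have h₁ := hs i
  rw [Finset.sum_comm, Finset.sum_eq_zero fun j _ => ?_] at h₁
  · exact zero_ne_one h₁
  · rw [← Matrix.sum_apply]
    exact le_antisymm (h j) (totalT_nonneg hT i j)

variable [DecidableEq S]

lemma totalT_pow_nonneg (hT : HMMNonneg T) (n : ℕ) (i j : S) : 0 ≤ (totalT T ^ n) i j := by
  induction n generalizing j with
  | zero => rw [pow_zero, Matrix.one_apply]; split_ifs <;> simp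
  | succ n ih =>
    rw [pow_succ, Matrix.mul_apply]
    exact Finset.sum_nonneg fun k _ => mul_nonneg (ih k) (totalT_nonneg hT k j)

lemma totalT_pow_succ_pos (hT : HMMNonneg T) {n : ℕ} {i j k : S} (hij : 0 < (totalT T ^ n) i j)
    (hjk : 0 < totalT T j k) : 0 < (totalT T ^ (n + 1)) i k := by
  rw [pow_succ, Matrix.mul_apply]
  exact Finset.sum_pos' (fun l _ => mul_nonneg (totalT_pow_nonneg hT n i l) (totalT_nonneg hT l k))
    ⟨j, Finset.mem_univ j, mul_pos hij hjk⟩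

/-- An irreducible chain with a strictly positive stationary distribution has no other one. -/
lemma IsStationaryDist.eq_of_irreducible {π ν : S → ℝ} (hT : HMMNonneg T) (hirr : Irreducible' T)
    (hπ : IsStationaryDist T π) (hpos : ∀ i, 0 < π i) (hν : IsStationaryDist T ν) : ν = π := by
  have hne : (Finset.univ : Finset S).Nonempty := by
    by_contra h
    have h₁ := hπ.2.1
    rw [Finset.not_nonempty_iff_eq_empty.1 h, Finset.sum_empty] at h₁
    exact zero_ne_one h₁
  obtain ⟨i₀, -, hi₀⟩ := Finset.exists_min_image Finset.univ (fun i => ν i / π i) hne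
  set c := ν i₀ / π i₀ with hc
  set d : S → ℝ := fun i => ν i - c * π i with hd
  have hd_nonneg (i : S) : 0 ≤ d i :=
    sub_nonneg.2 ((le_div_iff₀ (hpos i)).1 (hi₀ i (Finset.mem_univ i)))
  have hd_zero : d i₀ = 0 := by
    simp only [hd, hc, div_mul_cancel₀ _ (hpos i₀).ne', sub_self]
  have hd_stat : Matrix.vecMul d (totalT T) = d := by
    funext j
    simp only [Matrix.vecMul, dotProduct, hd, sub_mul, mul_assoc, Finset.sum_sub_distrib,
      ← Finset.mul_sum, hπ.2.2 j, hν.2.2 j]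
  have hd_pow (n : ℕ) : Matrix.vecMul d (totalT T ^ n) = d := by
    induction n with
    | zero => simp
    | succ n ih => rw [pow_succ, ← Matrix.vecMul_vecMul, ih, hd_stat]
  have hνπ (j : S) : ν j = c * π j := by
    by_contra hj
    have hdj : 0 < d j := lt_of_le_of_ne (hd_nonneg j) fun h => hj (sub_eq_zero.1 h.symm)
    obtain ⟨n, -, hn⟩ := hirr j i₀
    have h := congrFun (hd_pow n) i₀
    rw [hd_zero] at h
    refine (Finset.sum_pos' (fun k _ => mul_nonneg (hd_nonneg k) (totalT_pow_nonneg hT n k i₀))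
      ⟨j, Finset.mem_univ j, mul_pos hdj hn⟩).ne' h
  have hc_one : c = 1 := by
    have h := hν.2.1
    rwa [Finset.sum_congr rfl fun j _ => hνπ j, ← Finset.mul_sum, hπ.2.1, mul_one] at h
  funext j
  rw [hνπ j, hc_one, one_mul]

end HMM

lemma FinitelyCharacterized.histT_irreducible [Fintype X] [MeasurableSpace X]
    [MeasurableSingletonClass X] {μ : Measure (ℤ → X)} [IsProbabilityMeasure μ] {N : ℕ}
    {p : Fin N → (ℕ → X)} (hstat : Stationary μ) (herg : Ergodic' μ)
    (hfc : FinitelyCharacterized μ p) : Irreducible' (histT μ p) := by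
  intro i j
  have hT := hfc.histT_nonneg
  set R : Set (Fin N) := {k | ∃ n : ℕ, 0 < n ∧ 0 < (totalT (histT μ p) ^ n) i k} with hR
  set B : Set (ℤ → X) := ⋃ k ∈ R, classEvent μ (p k) with hB
  have hBm : MeasurableSet B :=
    MeasurableSet.biUnion R.to_countable fun k _ => measurableSet_classEvent (p k)
  have hnull (k l : Fin N) (hkl : ¬ 0 < totalT (histT μ p) k l) :
      ∀ᵐ ω ∂μ, ω ∉ classEvent μ (p k) ∩ shift ⁻¹' classEvent μ (p l) := by
    have h := hfc.measureReal_inter_preimage hstat k l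
    rw [le_antisymm (not_lt.1 hkl) (totalT_nonneg hT k l), mul_zero, measureReal_eq_zero_iff] at h
    exact measure_eq_zero_iff_ae_notMem.1 h
  have hsub : B ≤ᵐ[μ] shift ⁻¹' B := by
    have hall : ∀ᵐ ω ∂μ, ∀ k l, ¬ 0 < totalT (histT μ p) k l →
        ω ∉ classEvent μ (p k) ∩ shift ⁻¹' classEvent μ (p l) := by
      simp only [ae_all_iff]
      exact hnull
    filter_upwards [hall, hstat.measurePreserving.quasiMeasurePreserving.ae
      hfc.ae_exists_mem_classEvent] with ω hω hnext hωB
    obtain ⟨k, ⟨n, -, hn⟩, hk⟩ := Set.mem_iUnion₂.1 hωB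
    obtain ⟨l, hl⟩ := hnext
    have hkl : 0 < totalT (histT μ p) k l := by
      by_contra h
      exact hω k l h ⟨hk, hl⟩
    exact Set.mem_iUnion₂.2 ⟨l, ⟨n + 1, n.succ_pos, totalT_pow_succ_pos hT hn hkl⟩, hl⟩
  rcases (hstat.ergodic herg).ae_empty_or_univ_of_ae_le_preimage hBm.nullMeasurableSet hsub
    with h | h
  · obtain ⟨k, hk⟩ := (hfc.histT_stochastic hstat).exists_totalT_pos hT i
    have hkR : k ∈ R := ⟨1, one_pos, by rwa [pow_one]⟩
    have hpos := hfc.measureReal_classEvent_pos k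
    rw [measureReal_def, measure_mono_null (Set.subset_biUnion_of_mem (u := fun k =>
      classEvent μ (p k)) hkR) (ae_eq_empty.1 h), ENNReal.toReal_zero] at hpos
    exact absurd hpos (lt_irrefl 0)
  · by_contra hj
    have hdisj : classEvent μ (p j) ⊆ Bᶜ := by
      intro ω hω hωB
      obtain ⟨k, hk, hωk⟩ := Set.mem_iUnion₂.1 hωB
      have hkj : k ≠ j := fun h => hj (h ▸ hk)
      exact Set.disjoint_left.1 (hfc.pairwise_disjoint hkj) hωk hω
    have hpos := hfc.measureReal_classEvent_pos j
    rw [measureReal_def, measure_mono_null hdisj (ae_eq_univ.1 h), ENNReal.toReal_zero] at hpos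
    exact absurd hpos (lt_irrefl 0)

end EM

namespace EM

/-- The history ε-machine of a finitely characterized, stationary, ergodic
process is a generator ε-machine (valid HMM, unifilar, probabilistically distinct states,
strongly connected), its unique stationary distribution is μ = (ℙ⁻(E_1),…,ℙ⁻(E_N)),
and it generates the original process. -/
theorem history_is_generator
    {X : Type*} [Fintype X] [MeasurableSpace X] [MeasurableSingletonClass X]
    {N : ℕ} (μ : Measure (ℤ → X)) [IsProbabilityMeasure μ]
    (hstat : Stationary μ) (herg : Ergodic' μ)
    (p : Fin N → (ℕ → X)) (hfc : FinitelyCharacterized μ p) :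
    HMMNonneg (histT μ p) ∧ HMMStochastic (histT μ p) ∧
    Unifilar (histT μ p) ∧ ProbDistinct (histT μ p) ∧ Irreducible' (histT μ p) ∧
    IsStationaryDist (histT μ p) (fun i => (pastMeasure μ (classOf μ (p i))).toReal) ∧
    (∀ ν : Fin N → ℝ, IsStationaryDist (histT μ p) ν →
      ν = fun i => (pastMeasure μ (classOf μ (p i))).toReal) ∧
    (∀ w : List X, w ≠ [] → wordProb μ w =
      ∑ j, ∑ i, (pastMeasure μ (classOf μ (p i))).toReal * wordMatrix (histT μ p) w i j) := by
  simp only [pastMeasure_classOf, ← measureReal_def]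
  have hirr := hfc.histT_irreducible hstat herg
  have hdist := hfc.isStationaryDist hstat
  exact ⟨hfc.histT_nonneg, hfc.histT_stochastic hstat, hfc.histT_unifilar,
    hfc.histT_probDistinct hstat, hirr, hdist,
    fun ν hν => hdist.eq_of_irreducible hfc.histT_nonneg hirr hfc.measureReal_classEvent_pos hν,
    fun w _ => hfc.wordProb_eq_sum hstat w⟩

end EM
end

section
/- For any generator ε-machine with states σ_1,…,σ_N, matrices {T^(x)}, and stationary distribution π, define for each word w with ℙ(w) = ‖π T^(w)‖₁ > 0 the belief distribution φ(w) = π T^(w) / ‖π T^(w)‖₁ and the observer's doubt Q(w) = 1 − max_{1≤i≤N} φ(w)_i. Then there exist constants K > 0 and 0 < α < 1 such that for every t ∈ ℕ, the total probability of length-t words whose doubt exceeds α^t is at most K α^t: Σ_{w : |w| = t, ℙ(w) > 0, Q(w) > α^t} ℙ(w) ≤ K α^t. -/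
open MeasureTheory Filter Topology
open scoped Classical

namespace EM

section Overlap

variable {X : Type*} {S : Type*} [Fintype S] [DecidableEq S]

lemma wordMatrix_append (T : X → Matrix S S ℝ) (u v : List X) :
    wordMatrix T (u ++ v) = wordMatrix T u * wordMatrix T v := by
  simp [wordMatrix]

lemma wordMatrix_cons (T : X → Matrix S S ℝ) (x : X) (w : List X) :
    wordMatrix T (x :: w) = T x * wordMatrix T w := by
  simp [wordMatrix]

lemma wordMatrix_nonneg {T : X → Matrix S S ℝ} (hT : ∀ x i j, 0 ≤ T x i j) (w : List X) :
    ∀ i j, 0 ≤ wordMatrix T w i j := by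
  induction w with
  | nil =>
    intro i j
    simp only [wordMatrix, List.map_nil, List.prod_nil, Matrix.one_apply]
    split_ifs <;> norm_num
  | cons x w ih =>
    intro i j
    rw [wordMatrix_cons, Matrix.mul_apply]
    exact Finset.sum_nonneg fun k _ => mul_nonneg (hT x i k) (ih k j)

/-- Under unifilarity a word leads from each state to at most one state. -/
lemma wordMatrix_unifilar {T : X → Matrix S S ℝ} (hT : ∀ x i j, 0 ≤ T x i j)
    (hU : Unifilar T) (w : List X) :
    ∀ i k l, wordMatrix T w i k ≠ 0 → wordMatrix T w i l ≠ 0 → k = l := by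
  induction w with
  | nil =>
    intro i k l hk hl
    simp only [wordMatrix, List.map_nil, List.prod_nil, Matrix.one_apply, ne_eq,
      ite_eq_right_iff, one_ne_zero, imp_false, not_not] at hk hl
    exact hk.symm.trans hl
  | cons x w ih =>
    intro i k l hk hl
    rw [wordMatrix_cons, Matrix.mul_apply] at hk hl
    obtain ⟨a, -, ha⟩ := Finset.exists_ne_zero_of_sum_ne_zero hk
    obtain ⟨b, -, hb⟩ := Finset.exists_ne_zero_of_sum_ne_zero hl
    have hab : a = b := hU x i a b
      ((hT x i a).lt_of_ne' (left_ne_zero_of_mul ha))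
      ((hT x i b).lt_of_ne' (left_ne_zero_of_mul hb))
    subst hab
    exact ih a k l (right_ne_zero_of_mul ha) (right_ne_zero_of_mul hb)

lemma sqrt_sum_le {ι : Type*} (s : Finset ι) (f : ι → ℝ) (hf : ∀ i, 0 ≤ f i) :
    √(∑ i ∈ s, f i) ≤ ∑ i ∈ s, √(f i) := by
  classical
  induction s using Finset.induction_on with
  | empty => simp
  | insert a s ha ih =>
    rw [Finset.sum_insert ha, Finset.sum_insert ha]
    have hs : 0 ≤ ∑ i ∈ s, f i := Finset.sum_nonneg fun i _ => hf i
    have hadd : √(f a + ∑ i ∈ s, f i) ≤ √(f a) + √(∑ i ∈ s, f i) :=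
      Real.sqrt_le_iff.2 ⟨by positivity, by
        nlinarith [Real.sq_sqrt (hf a), Real.sq_sqrt hs,
          mul_nonneg (Real.sqrt_nonneg (f a)) (Real.sqrt_nonneg (∑ i ∈ s, f i))]⟩
    exact hadd.trans (by gcongr)

lemma sum_sqrt_eq_sqrt_sum {ι : Type*} [Fintype ι] (f : ι → ℝ)
    (h : ∀ i j, f i ≠ 0 → f j ≠ 0 → i = j) : ∑ i, √(f i) = √(∑ i, f i) := by
  by_cases h0 : ∀ i, f i = 0
  · simp [h0]
  · push Not at h0
    obtain ⟨a, ha⟩ := h0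
    have hb : ∀ b, b ≠ a → f b = 0 := fun b hba => by
      by_contra hb
      exact hba (h b a hb ha)
    rw [Fintype.sum_eq_single a fun b hba => by simp [hb b hba],
      Fintype.sum_eq_single a hb]

/-- The weight with which the word `w` fails to merge the states `i` and `j`: the sum of
`√(T^(w)_{ik} T^(w)_{jl})` over pairs of distinct states `k ≠ l`. -/
noncomputable def overlap (T : X → Matrix S S ℝ) (w : List X) (i j : S) : ℝ :=
  ∑ k, ∑ l, if k = l then 0 else √(wordMatrix T w i k * wordMatrix T w j l)

lemma overlap_nonneg (T : X → Matrix S S ℝ) (w : List X) (i j : S) : 0 ≤ overlap T w i j :=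
  Finset.sum_nonneg fun k _ => Finset.sum_nonneg fun l _ => by split_ifs <;> positivity

lemma overlap_self {T : X → Matrix S S ℝ} (hT : ∀ x i j, 0 ≤ T x i j) (hU : Unifilar T)
    (w : List X) (i : S) : overlap T w i i = 0 := by
  refine Finset.sum_eq_zero fun k _ => Finset.sum_eq_zero fun l _ => ?_
  split_ifs with hkl
  · rfl
  · rw [Real.sqrt_eq_zero']
    refine le_of_eq ?_
    by_contra h
    exact hkl (wordMatrix_unifilar hT hU w i k l (left_ne_zero_of_mul h) (right_ne_zero_of_mul h))

lemma overlap_le_sqrt {T : X → Matrix S S ℝ} (hT : ∀ x i j, 0 ≤ T x i j) (hU : Unifilar T)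
    (w : List X) (i j : S) :
    overlap T w i j ≤ √(stateWordProb T i w * stateWordProb T j w) := by
  have hW := wordMatrix_nonneg hT w
  calc overlap T w i j
      ≤ ∑ k, ∑ l, √(wordMatrix T w i k) * √(wordMatrix T w j l) := by
        refine Finset.sum_le_sum fun k _ => Finset.sum_le_sum fun l _ => ?_
        split_ifs
        · positivity
        · rw [Real.sqrt_mul (hW i k)]
    _ = √(stateWordProb T i w * stateWordProb T j w) := by
        rw [← Finset.sum_mul_sum, stateWordProb, stateWordProb,
          Real.sqrt_mul (Finset.sum_nonneg fun k _ => hW i k),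
          sum_sqrt_eq_sqrt_sum _ (wordMatrix_unifilar hT hU w i),
          sum_sqrt_eq_sqrt_sum _ (wordMatrix_unifilar hT hU w j)]

lemma overlap_append_le {T : X → Matrix S S ℝ} (hT : ∀ x i j, 0 ≤ T x i j) (hU : Unifilar T)
    (u v : List X) (i j : S) :
    overlap T (u ++ v) i j ≤ ∑ a, ∑ b,
      if a = b then 0 else √(wordMatrix T u i a * wordMatrix T u j b) * overlap T v a b := by
  have hu := wordMatrix_nonneg hT u
  have hv := wordMatrix_nonneg hT v
  have key : ∀ k l, (if k = l then 0
        else √(wordMatrix T (u ++ v) i k * wordMatrix T (u ++ v) j l)) ≤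
      ∑ a, ∑ b, √(wordMatrix T u i a * wordMatrix T u j b) *
        (if k = l then 0 else √(wordMatrix T v a k * wordMatrix T v b l)) := by
    intro k l
    split_ifs with hkl
    · simp
    · rw [wordMatrix_append, Matrix.mul_apply, Matrix.mul_apply, Finset.sum_mul_sum]
      refine (sqrt_sum_le _ _ fun a => Finset.sum_nonneg fun b _ => ?_).trans
        (Finset.sum_le_sum fun a _ => (sqrt_sum_le _ _ fun b => ?_).trans
          (Finset.sum_le_sum fun b _ => ?_))
      · exact mul_nonneg (mul_nonneg (hu _ _) (hv _ _)) (mul_nonneg (hu _ _) (hv _ _))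
      · exact mul_nonneg (mul_nonneg (hu _ _) (hv _ _)) (mul_nonneg (hu _ _) (hv _ _))
      · rw [← Real.sqrt_mul (mul_nonneg (hu _ _) (hu _ _))]
        exact le_of_eq (by ring_nf)
  calc overlap T (u ++ v) i j
      ≤ ∑ k, ∑ l, ∑ a, ∑ b, √(wordMatrix T u i a * wordMatrix T u j b) *
        (if k = l then 0 else √(wordMatrix T v a k * wordMatrix T v b l)) :=
        Finset.sum_le_sum fun k _ => Finset.sum_le_sum fun l _ => key k l
    _ = ∑ a, ∑ b, √(wordMatrix T u i a * wordMatrix T u j b) * overlap T v a b := by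
        simp_rw [overlap, Finset.mul_sum]
        rw [Finset.sum_congr rfl fun k _ => Finset.sum_comm, Finset.sum_comm]
        refine Finset.sum_congr rfl fun a _ => ?_
        rw [Finset.sum_congr rfl fun k _ => Finset.sum_comm, Finset.sum_comm]
    _ ≤ _ := by
        refine Finset.sum_le_sum fun a _ => Finset.sum_le_sum fun b _ => ?_
        split_ifs with hab
        · rw [hab, overlap_self hT hU, mul_zero]
        · exact le_rfl

lemma sum_ofFn_succ [Fintype X] (n : ℕ) (f : List X → ℝ) :
    ∑ w : Fin (n + 1) → X, f (List.ofFn w) =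
      ∑ x, ∑ w : Fin n → X, f (x :: List.ofFn w) := by
  rw [← (Fin.consEquiv fun _ => X).sum_comp, Fintype.sum_prod_type]
  simp [Fin.consEquiv, List.ofFn_succ]

lemma sum_ofFn_add [Fintype X] (m n : ℕ) (f : List X → ℝ) :
    ∑ w : Fin (m + n) → X, f (List.ofFn w) =
      ∑ u : Fin m → X, ∑ v : Fin n → X, f (List.ofFn u ++ List.ofFn v) := by
  induction m generalizing f with
  | zero => rw [Nat.zero_add]; simp
  | succ m ih =>
    rw [Nat.succ_add, sum_ofFn_succ,
      sum_ofFn_succ m fun u => ∑ v : Fin n → X, f (u ++ List.ofFn v)]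
    exact Finset.sum_congr rfl fun x _ => ih fun w => f (x :: w)

lemma sum_stateWordProb [Fintype X] {T : X → Matrix S S ℝ} (hT : HMMStochastic T) (n : ℕ)
    (i : S) : ∑ w : Fin n → X, stateWordProb T i (List.ofFn w) = 1 := by
  induction n generalizing i with
  | zero => simp [stateWordProb, wordMatrix, Matrix.one_apply]
  | succ n ih =>
    rw [sum_ofFn_succ, ← hT i]
    refine Finset.sum_congr rfl fun x _ => ?_
    have h : ∀ w : List X, stateWordProb T i (x :: w) = ∑ j, T x i j * stateWordProb T j w := by
      intro w
      simp_rw [stateWordProb, wordMatrix_cons, Matrix.mul_apply, Finset.mul_sum]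
      exact Finset.sum_comm
    simp_rw [h]
    rw [Finset.sum_comm]
    simp_rw [← Finset.mul_sum, ih, mul_one]

/-- The total overlap of the states `i` and `j` over all words of length `n`. -/
noncomputable def totalOverlap [Fintype X] (T : X → Matrix S S ℝ) (n : ℕ) (i j : S) : ℝ :=
  ∑ w : Fin n → X, overlap T (List.ofFn w) i j

lemma sqrt_mul_le_half_add {p q : ℝ} (hp : 0 ≤ p) (hq : 0 ≤ q) : √(p * q) ≤ (p + q) / 2 :=
  Real.sqrt_le_iff.2 ⟨by positivity, by nlinarith [sq_nonneg (p - q)]⟩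

lemma sqrt_mul_lt_half_add {p q : ℝ} (hp : 0 ≤ p) (hq : 0 ≤ q) (hpq : p ≠ q) :
    √(p * q) < (p + q) / 2 := by
  have h : 0 < (p - q) ^ 2 := by
    have := sub_ne_zero.2 hpq
    positivity
  have hs : 0 < p + q := by
    rcases hp.eq_or_lt with rfl | hp'
    · have := hq.lt_of_ne hpq
      linarith
    · linarith
  exact (Real.sqrt_lt' (by positivity)).2 (by nlinarith)

lemma stateWordProb_nonneg {T : X → Matrix S S ℝ} (hT : ∀ x i j, 0 ≤ T x i j) (i : S)
    (w : List X) : 0 ≤ stateWordProb T i w :=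
  Finset.sum_nonneg fun _ _ => wordMatrix_nonneg hT w _ _

lemma sum_half_add_stateWordProb [Fintype X] {T : X → Matrix S S ℝ} (hS : HMMStochastic T)
    (n : ℕ) (i j : S) :
    ∑ w : Fin n → X, (stateWordProb T i (List.ofFn w) + stateWordProb T j (List.ofFn w)) / 2
      = 1 := by
  rw [← Finset.sum_div, Finset.sum_add_distrib, sum_stateWordProb hS, sum_stateWordProb hS]
  norm_num

lemma totalOverlap_le_one [Fintype X] {T : X → Matrix S S ℝ} (hT : ∀ x i j, 0 ≤ T x i j)
    (hS : HMMStochastic T) (hU : Unifilar T) (n : ℕ) (i j : S) : totalOverlap T n i j ≤ 1 := by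
  rw [← sum_half_add_stateWordProb hS n i j]
  exact Finset.sum_le_sum fun w _ => (overlap_le_sqrt hT hU _ i j).trans
    (sqrt_mul_le_half_add (stateWordProb_nonneg hT _ _) (stateWordProb_nonneg hT _ _))

lemma totalOverlap_lt_one [Fintype X] {T : X → Matrix S S ℝ} (hT : ∀ x i j, 0 ≤ T x i j)
    (hS : HMMStochastic T) (hU : Unifilar T) {i j : S} (w : List X)
    (hw : stateWordProb T i w ≠ stateWordProb T j w) : totalOverlap T w.length i j < 1 := by
  rw [← sum_half_add_stateWordProb hS w.length i j]
  refine Finset.sum_lt_sum (fun w _ => (overlap_le_sqrt hT hU _ i j).trans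
    (sqrt_mul_le_half_add (stateWordProb_nonneg hT _ _) (stateWordProb_nonneg hT _ _)))
    ⟨w.get, Finset.mem_univ _, ?_⟩
  rw [List.ofFn_get]
  exact (overlap_le_sqrt hT hU _ i j).trans_lt
    (sqrt_mul_lt_half_add (stateWordProb_nonneg hT _ _) (stateWordProb_nonneg hT _ _) hw)

lemma totalOverlap_add_le [Fintype X] {T : X → Matrix S S ℝ} (hT : ∀ x i j, 0 ≤ T x i j)
    (hU : Unifilar T) (m n : ℕ) (i j : S) {c : ℝ} (hc : ∀ a b, totalOverlap T n a b ≤ c) :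
    totalOverlap T (m + n) i j ≤ totalOverlap T m i j * c := by
  rw [totalOverlap, sum_ofFn_add m n fun w => overlap T w i j, totalOverlap, Finset.sum_mul]
  refine Finset.sum_le_sum fun u _ => ?_
  refine (Finset.sum_le_sum fun v _ => overlap_append_le hT hU _ _ i j).trans ?_
  rw [overlap, Finset.sum_comm, Finset.sum_mul]
  refine Finset.sum_le_sum fun a _ => ?_
  rw [Finset.sum_comm, Finset.sum_mul]
  refine Finset.sum_le_sum fun b _ => ?_
  split_ifs
  · simp
  · rw [← Finset.mul_sum]
    exact mul_le_mul_of_nonneg_left (hc a b) (Real.sqrt_nonneg _)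

/-- Some length `n > 0` contracts the total overlap of every pair of states. -/
lemma exists_totalOverlap_le [Fintype X] {T : X → Matrix S S ℝ} (hT : ∀ x i j, 0 ≤ T x i j)
    (hS : HMMStochastic T) (hU : Unifilar T) (hD : ProbDistinct T) :
    ∃ n : ℕ, 0 < n ∧ ∃ r : ℝ, 0 < r ∧ r < 1 ∧ ∀ i j, totalOverlap T n i j ≤ r := by
  have h1 : ∀ p : S × S, ∃ n, totalOverlap T n p.1 p.2 < 1 := by
    rintro ⟨i, j⟩
    by_cases hij : i = j
    · exact ⟨0, by simp [hij, totalOverlap, overlap_self hT hU]⟩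
    · obtain ⟨w, -, hw⟩ := hD i j hij
      exact ⟨w.length, totalOverlap_lt_one hT hS hU w hw⟩
  choose n hn using h1
  obtain ⟨N, hN⟩ := Finset.exists_le (Finset.univ.image n)
  have h2 : ∀ p : S × S, totalOverlap T (N + 1) p.1 p.2 < 1 := by
    intro p
    have hle : n p ≤ N := hN _ (Finset.mem_image_of_mem n (Finset.mem_univ p))
    obtain ⟨m, hm⟩ := Nat.exists_eq_add_of_le (hle.trans N.le_succ)
    rw [← Nat.succ_eq_add_one, hm]
    refine (totalOverlap_add_le hT hU (n p) m p.1 p.2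
      (totalOverlap_le_one hT hS hU m)).trans_lt ?_
    rw [mul_one]
    exact hn p
  have h3 : ∃ r : ℝ, 0 < r ∧ r < 1 ∧ ∀ p : S × S, totalOverlap T (N + 1) p.1 p.2 ≤ r := by
    let s : Finset ℝ := insert (1 / 2)
      (Finset.univ.image fun p : S × S => totalOverlap T (N + 1) p.1 p.2)
    have hs : s.Nonempty := Finset.insert_nonempty _ _
    refine ⟨s.max' hs, ?_, ?_, fun p => ?_⟩
    · exact (by norm_num : (0 : ℝ) < 1 / 2).trans_le
        (s.le_max' _ (Finset.mem_insert_self _ _))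
    · rw [Finset.max'_lt_iff]
      intro y hy
      rcases Finset.mem_insert.1 hy with rfl | hy
      · norm_num
      · obtain ⟨p, -, rfl⟩ := Finset.mem_image.1 hy
        exact h2 p
    · exact s.le_max' _ (Finset.mem_insert_of_mem
        (Finset.mem_image_of_mem _ (Finset.mem_univ p)))
  obtain ⟨r, hr0, hr1, hr⟩ := h3
  exact ⟨N + 1, N.succ_pos, r, hr0, hr1, fun i j => hr (i, j)⟩

/-- The total overlap of any two states decays exponentially in the word length. -/
lemma exists_totalOverlap_le_pow [Fintype X] {T : X → Matrix S S ℝ}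
    (hT : ∀ x i j, 0 ≤ T x i j)
    (hS : HMMStochastic T) (hU : Unifilar T) (hD : ProbDistinct T) :
    ∃ C α : ℝ, 0 < C ∧ 0 < α ∧ α < 1 ∧
      ∀ t i j, totalOverlap T t i j ≤ C * (α ^ t * α ^ t) := by
  obtain ⟨n, hn, r, hr0, hr1, hr⟩ := exists_totalOverlap_le hT hS hU hD
  have h2n : 2 * n ≠ 0 := by omega
  have hα0 : 0 < r ^ ((2 * n : ℕ) : ℝ)⁻¹ := Real.rpow_pos_of_pos hr0 _
  have hα1 : r ^ ((2 * n : ℕ) : ℝ)⁻¹ < 1 := Real.rpow_lt_one hr0.le hr1 (by positivity)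
  have hαn := Real.rpow_inv_natCast_pow hr0.le h2n
  generalize r ^ ((2 * n : ℕ) : ℝ)⁻¹ = α at hα0 hα1 hαn
  rw [two_mul, pow_add] at hαn
  refine ⟨r⁻¹, α, by positivity, hα0, hα1, fun t => ?_⟩
  induction t using Nat.strong_induction_on with
  | _ t ih =>
    intro i j
    rcases lt_or_ge t n with htn | htn
    · refine (totalOverlap_le_one hT hS hU t i j).trans ?_
      rw [inv_mul_eq_div, one_le_div hr0, ← hαn]
      have := pow_le_pow_of_le_one hα0.le hα1.le htn.le
      gcongr
    · obtain ⟨s, rfl⟩ := Nat.exists_eq_add_of_le htn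
      refine (totalOverlap_add_le hT hU n s i j (ih s (by omega))).trans ?_
      calc totalOverlap T n i j * (r⁻¹ * (α ^ s * α ^ s))
          ≤ r * (r⁻¹ * (α ^ s * α ^ s)) := by
            gcongr
            exact hr i j
        _ = r⁻¹ * (α ^ (n + s) * α ^ (n + s)) := by
            rw [pow_add]
            linear_combination (-r⁻¹ * (α ^ s * α ^ s)) * hαn

/-- The mass missed by the most likely final state is controlled by the overlaps. -/
lemma sum_sub_le_sum_overlap {T : X → Matrix S S ℝ} (hT : ∀ x i j, 0 ≤ T x i j)
    {π : S → ℝ} (hπ0 : ∀ i, 0 ≤ π i) (hπ1 : ∀ i, π i ≤ 1) (w : List X) (k : S)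
    (hk : ∀ l, ∑ i, π i * wordMatrix T w i l ≤ ∑ i, π i * wordMatrix T w i k) :
    ∑ l, ∑ i, π i * wordMatrix T w i l - ∑ i, π i * wordMatrix T w i k ≤
      ∑ i, ∑ j, overlap T w i j := by
  have hW := wordMatrix_nonneg hT w
  have hq : ∀ l, 0 ≤ ∑ i, π i * wordMatrix T w i l := fun l =>
    Finset.sum_nonneg fun i _ => mul_nonneg (hπ0 i) (hW i l)
  have key : ∀ l, ∑ i, π i * wordMatrix T w i l ≤
      ∑ i, ∑ j, √(wordMatrix T w i l * wordMatrix T w j k) := by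
    intro l
    calc ∑ i, π i * wordMatrix T w i l
        ≤ √((∑ i, π i * wordMatrix T w i l) * ∑ j, π j * wordMatrix T w j k) :=
          Real.le_sqrt_of_sq_le (by rw [sq]; exact mul_le_mul_of_nonneg_left (hk l) (hq l))
      _ ≤ ∑ i, ∑ j, √(π i * wordMatrix T w i l * (π j * wordMatrix T w j k)) := by
          rw [Finset.sum_mul_sum]
          have h0 : ∀ i j, 0 ≤ π i * wordMatrix T w i l * (π j * wordMatrix T w j k) :=
            fun i j => mul_nonneg (mul_nonneg (hπ0 i) (hW i l)) (mul_nonneg (hπ0 j) (hW j k))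
          exact (sqrt_sum_le _ _ fun i => Finset.sum_nonneg fun j _ => h0 i j).trans
            (Finset.sum_le_sum fun i _ => sqrt_sum_le _ _ (h0 i))
      _ ≤ _ := by
          refine Finset.sum_le_sum fun i _ => Finset.sum_le_sum fun j _ => Real.sqrt_le_sqrt ?_
          exact mul_le_mul (mul_le_of_le_one_left (hW i l) (hπ1 i))
            (mul_le_of_le_one_left (hW j k) (hπ1 j)) (mul_nonneg (hπ0 j) (hW j k)) (hW i l)
  calc ∑ l, ∑ i, π i * wordMatrix T w i l - ∑ i, π i * wordMatrix T w i k
      = ∑ l ∈ Finset.univ.erase k, ∑ i, π i * wordMatrix T w i l := by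
        rw [← Finset.add_sum_erase _ _ (Finset.mem_univ k)]
        ring
    _ ≤ ∑ l ∈ Finset.univ.erase k, ∑ i, ∑ j,
          if l = k then 0 else √(wordMatrix T w i l * wordMatrix T w j k) := by
        refine Finset.sum_le_sum fun l hl => ?_
        simp only [Finset.ne_of_mem_erase hl, if_false]
        exact key l
    _ ≤ ∑ l, ∑ i, ∑ j, if l = k then 0 else √(wordMatrix T w i l * wordMatrix T w j k) := by
        refine Finset.sum_le_sum_of_subset_of_nonneg (Finset.subset_univ _) fun l _ _ =>
          Finset.sum_nonneg fun i _ => Finset.sum_nonneg fun j _ => ?_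
        split_ifs <;> positivity
    _ = ∑ i, ∑ j, ∑ l, if l = k then 0 else √(wordMatrix T w i l * wordMatrix T w j k) := by
        rw [Finset.sum_comm]
        exact Finset.sum_congr rfl fun i _ => Finset.sum_comm
    _ ≤ ∑ i, ∑ j, overlap T w i j := by
        refine Finset.sum_le_sum fun i _ => Finset.sum_le_sum fun j _ =>
          Finset.sum_le_sum fun l _ => ?_
        refine Finset.single_le_sum
          (f := fun m => if l = m then 0 else √(wordMatrix T w i l * wordMatrix T w j m))
          (fun m _ => ?_) (Finset.mem_univ k)
        split_ifs <;> positivity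

end Overlap

/-- Exponential synchronization bound. For a generator ε-machine with
stationary distribution π, with ℙ(w) = ‖π T^(w)‖₁, belief φ(w)_i = (π T^(w))_i / ‖π T^(w)‖₁
and doubt Q(w) = 1 - max_i φ(w)_i, there are K > 0 and 0 < α < 1 such that for every t,
the total probability of length-t words w with ℙ(w) > 0 and Q(w) > α^t is at most K α^t. -/
theorem synchronization_bound
    {X : Type*} [Fintype X]
    {S : Type*} [Fintype S] [DecidableEq S] [Nonempty S]
    (T : X → Matrix S S ℝ) (hgen : IsGenEM T)
    (π : S → ℝ) (hπ : IsStationaryDist T π) :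
    ∃ K α : ℝ, 0 < K ∧ 0 < α ∧ α < 1 ∧ ∀ t : ℕ,
      ∑ w : Fin t → X,
        (if 0 < ∑ j, ∑ i, π i * wordMatrix T (List.ofFn w) i j ∧
            1 - (Finset.univ.sup' Finset.univ_nonempty fun i =>
                (∑ k, π k * wordMatrix T (List.ofFn w) k i) /
                  ∑ j, ∑ k, π k * wordMatrix T (List.ofFn w) k j) > α ^ t
         then ∑ j, ∑ i, π i * wordMatrix T (List.ofFn w) i j else 0)
      ≤ K * α ^ t := by
  obtain ⟨hT, hS, -, hU, hD⟩ := hgen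
  obtain ⟨hπ0, hπ1, -⟩ := hπ
  have hπle : ∀ i, π i ≤ 1 := fun i =>
    hπ1 ▸ Finset.single_le_sum (fun j _ => hπ0 j) (Finset.mem_univ i)
  obtain ⟨C, α, hC, hα0, hα1, hG⟩ := exists_totalOverlap_le_pow hT hS hU hD
  have hcard : 0 < (Fintype.card S : ℝ) := by exact_mod_cast Fintype.card_pos
  refine ⟨Fintype.card S * Fintype.card S * C, α, by positivity, hα0, hα1, fun t => ?_⟩
  have hαt : 0 < α ^ t := pow_pos hα0 t
  refine le_of_mul_le_mul_right ?_ hαt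
  calc _ ≤ ∑ w : Fin t → X, ∑ i, ∑ j, overlap T (List.ofFn w) i j := by
        rw [Finset.sum_mul]
        refine Finset.sum_le_sum fun w _ => ?_
        split_ifs with h
        · obtain ⟨hP, hQ⟩ := h
          obtain ⟨k, -, hk⟩ := Finset.exists_mem_eq_sup' Finset.univ_nonempty fun i =>
            (∑ k, π k * wordMatrix T (List.ofFn w) k i) /
              ∑ j, ∑ k, π k * wordMatrix T (List.ofFn w) k j
          have hmax : ∀ l, ∑ i, π i * wordMatrix T (List.ofFn w) i l ≤
              ∑ i, π i * wordMatrix T (List.ofFn w) i k := fun l =>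
            (div_le_div_iff_of_pos_right hP).1 (hk ▸ Finset.le_sup' (fun i =>
              (∑ k, π k * wordMatrix T (List.ofFn w) k i) /
                ∑ j, ∑ k, π k * wordMatrix T (List.ofFn w) k j) (Finset.mem_univ l))
          refine le_trans ?_ (sum_sub_le_sum_overlap hT hπ0 hπle (List.ofFn w) k hmax)
          rw [hk] at hQ
          refine (mul_le_mul_of_nonneg_left (le_of_lt hQ) hP.le).trans_eq ?_
          rw [mul_sub, mul_one, mul_div_cancel₀ _ hP.ne']
        · rw [zero_mul]
          exact Finset.sum_nonneg fun i _ => Finset.sum_nonneg fun j _ => overlap_nonneg T _ i j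
    _ = ∑ i, ∑ j, totalOverlap T t i j := by
        rw [Finset.sum_comm]
        exact Finset.sum_congr rfl fun i _ => Finset.sum_comm
    _ ≤ ∑ _i : S, ∑ _j : S, C * (α ^ t * α ^ t) :=
        Finset.sum_le_sum fun i _ => Finset.sum_le_sum fun j _ => hG t i j
    _ = Fintype.card S * Fintype.card S * C * α ^ t * α ^ t := by
        simp only [Finset.sum_const, Finset.card_univ, nsmul_eq_mul]
        ring

end EM
end
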